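/- Let n ≥ 1, d > 0, let Ω ⊂ ℝⁿ be an open bounded domain with smooth boundary, and let a : cl(Ω) → ℝⁿ be a continuously differentiable vector field with div a = 0 on Ω. Assume f satisfies (F), g satisfies (G-ext), f'(0) + ln(g'(0)) > 0, and vol(Ω) < V_ex := Γ(1 + n/2)·[4dnπ/((n+2)·(f'(0) + ln(g'(0))))]^{n/2}, where Γ is the Gamma function. Then every solution of the impulsive reaction–diffusion system on Ω satisfies lim_{m→∞} N_m(x) = 0 for every x ∈ Ω. -/

import Mathlib

open Real Filter MeasureTheory
open scoped Topology ENNReal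

noncomputable section

/-- First-order partial derivative of `u` in the `i`-th coordinate direction. -/
def pd {n : ℕ} (u : EuclideanSpace ℝ (Fin n) → ℝ) (i : Fin n)
    (x : EuclideanSpace ℝ (Fin n)) : ℝ :=
  fderiv ℝ u x (EuclideanSpace.single i 1)

/-- Second-order partial derivative `∂ᵢ∂ⱼ u`. -/
def pd2 {n : ℕ} (u : EuclideanSpace ℝ (Fin n) → ℝ) (i j : Fin n)
    (x : EuclideanSpace ℝ (Fin n)) : ℝ :=
  pd (fun y => pd u j y) i x

/-- Laplacian of `u`. -/
def lap {n : ℕ} (u : EuclideanSpace ℝ (Fin n) → ℝ) (x : EuclideanSpace ℝ (Fin n)) : ℝ :=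
  ∑ i, pd2 u i i x

/-- Assumption (F): `f` is locally Lipschitz, `f 0 = 0`, `f` is differentiable at `0`
with derivative `f'0 ≠ 0`, and there is a differentiable `h` with `h 0 = h' 0 = 0` such that
`f'0 * N - h N ≤ f N ≤ f'0 * N` for all `N ≥ 0`. -/
def SatF (f : ℝ → ℝ) (f'0 : ℝ) : Prop :=
  LocallyLipschitz f ∧ f 0 = 0 ∧ HasDerivAt f f'0 0 ∧ f'0 ≠ 0 ∧
    ∃ h : ℝ → ℝ, Differentiable ℝ h ∧ h 0 = 0 ∧ deriv h 0 = 0 ∧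
      ∀ N : ℝ, 0 ≤ N → f'0 * N - h N ≤ f N ∧ f N ≤ f'0 * N

/-- Assumption (G-ext): `g : [0,∞) → [0,∞)` is continuous, `g 0 = 0`, `g N > 0` for `N > 0`,
`g` is differentiable at `0` (within `[0,∞)`) with derivative `g'0 > 0`, and
`g N ≤ g'0 * N` for all `N > 0`. -/
def SatGext (g : ℝ → ℝ) (g'0 : ℝ) : Prop :=
  ContinuousOn g (Set.Ici 0) ∧ g 0 = 0 ∧ (∀ N : ℝ, 0 < N → 0 < g N) ∧
    HasDerivWithinAt g g'0 (Set.Ici 0) 0 ∧ 0 < g'0 ∧ ∀ N : ℝ, 0 < N → g N ≤ g'0 * N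

/-- `Ω` has a `C^k` boundary: near every boundary point, `Ω` is the sublevel set of a
`C^k` function with nonvanishing differential, whose zero set is the boundary. -/
def HasCkBoundary {n : ℕ} (k : ℕ∞) (Ω : Set (EuclideanSpace ℝ (Fin n))) : Prop :=
  ∀ x ∈ frontier Ω, ∃ U : Set (EuclideanSpace ℝ (Fin n)),
    ∃ φ : EuclideanSpace ℝ (Fin n) → ℝ,
      IsOpen U ∧ x ∈ U ∧ ContDiffOn ℝ k φ U ∧ (∀ y ∈ U, fderiv ℝ φ y ≠ 0) ∧
        Ω ∩ U = {y ∈ U | φ y < 0} ∧ frontier Ω ∩ U = {y ∈ U | φ y = 0}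

/-- A solution of the impulsive reaction-diffusion system
`∂ₜ u⁽ᵐ⁾ = d Δu⁽ᵐ⁾ - a ⬝ ∇u⁽ᵐ⁾ + f (u⁽ᵐ⁾)` on `Ω × (0,1]` with hostile (Dirichlet) boundary
conditions, initial data `u⁽ᵐ⁾(·,0) = g (N_m ·)` and update rule `N_{m+1} = u⁽ᵐ⁾(·,1)`. -/
structure ImpSol (n : ℕ) (Ω : Set (EuclideanSpace ℝ (Fin n))) (d : ℝ)
    (a : EuclideanSpace ℝ (Fin n) → EuclideanSpace ℝ (Fin n)) (f g : ℝ → ℝ) where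
  N : ℕ → EuclideanSpace ℝ (Fin n) → ℝ
  u : ℕ → EuclideanSpace ℝ (Fin n) → ℝ → ℝ
  N_cont : ∀ m, ContinuousOn (N m) (closure Ω)
  N_nonneg : ∀ m, ∀ x ∈ closure Ω, 0 ≤ N m x
  N0_bdry : ∀ x ∈ frontier Ω, N 0 x = 0
  u_nonneg : ∀ m, ∀ x ∈ closure Ω, ∀ t ∈ Set.Icc (0:ℝ) 1, 0 ≤ u m x t
  u_cont : ∀ m, ContinuousOn (fun p : EuclideanSpace ℝ (Fin n) × ℝ => u m p.1 p.2)
    (closure Ω ×ˢ Set.Icc (0:ℝ) 1)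
  u_space_C2 : ∀ m, ∀ t ∈ Set.Ioc (0:ℝ) 1, ∀ x ∈ Ω, ContDiffAt ℝ 2 (fun y => u m y t) x
  u_time_C1 : ∀ m, ∀ x ∈ Ω, ∀ t ∈ Set.Ioc (0:ℝ) 1, ContDiffAt ℝ 1 (fun s => u m x s) t
  pde : ∀ m, ∀ x ∈ Ω, ∀ t ∈ Set.Ioc (0:ℝ) 1,
    deriv (fun s => u m x s) t =
      d * lap (fun y => u m y t) x - (∑ i, a x i * pd (fun y => u m y t) i x) + f (u m x t)
  bdry : ∀ m, ∀ x ∈ frontier Ω, ∀ t ∈ Set.Ioc (0:ℝ) 1, u m x t = 0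
  init : ∀ m, ∀ x ∈ Ω, u m x 0 = g (N m x)
  recur : ∀ m, ∀ x ∈ closure Ω, N (m + 1) x = u m x 1

lemma aux_second_deriv {k : ℝ → ℝ} (hk : ∀ᶠ t in 𝓝 (0:ℝ), DifferentiableAt ℝ k t)
    (hmax : IsLocalMax k 0) : deriv (deriv k) 0 ≤ 0 := by
  by_contra! h
  have h1 : deriv k 0 = 0 := hmax.deriv_eq_zero
  have hmin : IsLocalMin k 0 := isLocalMin_of_deriv_deriv_pos h h1 hk.self_of_nhds.continuousAt
  have hc : k =ᶠ[𝓝 0] fun _ => k 0 := by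
    filter_upwards [hmax, hmin] with t h1 h2 using le_antisymm h1 h2
  have h2 := (hc.deriv).deriv_eq
  simp at h2
  linarith

variable {n : ℕ}

lemma pd_add_smul {u v : EuclideanSpace ℝ (Fin n) → ℝ} {x : EuclideanSpace ℝ (Fin n)} (c : ℝ)
    (hu : DifferentiableAt ℝ u x) (hv : DifferentiableAt ℝ v x) (i : Fin n) :
    pd (fun y => u y + c * v y) i x = pd u i x + c * pd v i x := by
  unfold pd
  rw [fderiv_fun_add hu (hv.const_mul c), fderiv_const_mul hv]
  simp

lemma c2_pd_diff {u : EuclideanSpace ℝ (Fin n) → ℝ} {x : EuclideanSpace ℝ (Fin n)}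
    (hu : ContDiffAt ℝ 2 u x) (i : Fin n) : DifferentiableAt ℝ (fun y => pd u i y) x := by
  have : ContDiffAt ℝ 1 (fderiv ℝ u) x := hu.fderiv_right (by norm_num)
  exact (this.differentiableAt (by norm_num)).clm_apply (differentiableAt_const _)

lemma c2_ev_diff {u : EuclideanSpace ℝ (Fin n) → ℝ} {x : EuclideanSpace ℝ (Fin n)}
    (hu : ContDiffAt ℝ 2 u x) : ∀ᶠ y in 𝓝 x, DifferentiableAt ℝ u y := by
  filter_upwards [hu.eventually (by simp)] with y hy using hy.differentiableAt (by norm_num)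

lemma pd2_add_smul {u v : EuclideanSpace ℝ (Fin n) → ℝ} {x : EuclideanSpace ℝ (Fin n)} (c : ℝ)
    (hu : ContDiffAt ℝ 2 u x) (hv : ContDiffAt ℝ 2 v x) (i : Fin n) :
    pd2 (fun y => u y + c * v y) i i x = pd2 u i i x + c * pd2 v i i x := by
  unfold pd2
  rw [← pd_add_smul c (c2_pd_diff hu i) (c2_pd_diff hv i) i]
  have : (fun y => pd (fun y => u y + c * v y) i y) =ᶠ[𝓝 x]
      fun y => pd u i y + c * pd v i y := by
    filter_upwards [c2_ev_diff hu, c2_ev_diff hv] with y h1 h2 using pd_add_smul c h1 h2 i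
  show fderiv ℝ _ x _ = fderiv ℝ _ x _
  rw [this.fderiv_eq]

lemma lap_add_smul {u v : EuclideanSpace ℝ (Fin n) → ℝ} {x : EuclideanSpace ℝ (Fin n)} (c : ℝ)
    (hu : ContDiffAt ℝ 2 u x) (hv : ContDiffAt ℝ 2 v x) :
    lap (fun y => u y + c * v y) x = lap u x + c * lap v x := by
  unfold lap
  simp_rw [pd2_add_smul c hu hv]
  rw [Finset.sum_add_distrib, Finset.mul_sum]

lemma pd_localMax {φ : EuclideanSpace ℝ (Fin n) → ℝ} {x : EuclideanSpace ℝ (Fin n)}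
    (hm : IsLocalMax φ x) (i : Fin n) : pd φ i x = 0 := by
  unfold pd; rw [hm.fderiv_eq_zero]; simp

lemma lap_localMax {φ : EuclideanSpace ℝ (Fin n) → ℝ} {x : EuclideanSpace ℝ (Fin n)}
    (hφ : ContDiffAt ℝ 2 φ x) (hm : IsLocalMax φ x) : lap φ x ≤ 0 := by
  unfold lap
  refine Finset.sum_nonpos fun i _ => ?_
  set e : EuclideanSpace ℝ (Fin n) := EuclideanSpace.single i 1
  have hl : ∀ t : ℝ, HasDerivAt (fun t : ℝ => x + t • e) e t := fun t => by
    simpa using ((hasDerivAt_id t).smul_const e).const_add x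
  have hlc : Tendsto (fun t : ℝ => x + t • e) (𝓝 0) (𝓝 x) := by
    have := (hl 0).continuousAt.tendsto; simpa using this
  have hev : ∀ᶠ t in 𝓝 (0:ℝ), HasDerivAt (fun t : ℝ => φ (x + t • e)) (pd φ i (x + t • e)) t := by
    filter_upwards [hlc.eventually (c2_ev_diff hφ)] with t ht
    exact ht.hasFDerivAt.comp_hasDerivAt t (hl t)
  have h1 : deriv (fun t : ℝ => φ (x + t • e)) =ᶠ[𝓝 0] fun t => pd φ i (x + t • e) := by
    filter_upwards [hev] with t ht using ht.deriv
  have h2 : HasDerivAt (fun t : ℝ => pd φ i (x + t • e)) (pd2 φ i i x) 0 := by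
    have h3 : HasFDerivAt (fun y => pd φ i y) (fderiv ℝ (fun y => pd φ i y) x) (x + (0:ℝ) • e) := by
      simpa using (c2_pd_diff hφ i).hasFDerivAt
    exact h3.comp_hasDerivAt 0 (hl 0)
  have h4 := aux_second_deriv (k := fun t : ℝ => φ (x + t • e))
    (hev.mono fun t ht => ht.differentiableAt) (by
      have : ∀ᶠ t in 𝓝 (0:ℝ), φ (x + t • e) ≤ φ x := hlc.eventually hm
      simpa [IsLocalMax, IsMaxFilter] using this)
  rwa [h1.deriv_eq, h2.deriv] at h4

lemma comparison {d : ℝ} (hd : 0 < d) {Ω : Set (EuclideanSpace ℝ (Fin n))} (hopen : IsOpen Ω)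
    (hne : Ω.Nonempty) (hbdd : Bornology.IsBounded Ω)
    {a : EuclideanSpace ℝ (Fin n) → EuclideanSpace ℝ (Fin n)} {f g : ℝ → ℝ} {r γ μ : ℝ}
    (hf : ∀ N, 0 ≤ N → f N ≤ r * N) (hγ : 0 < γ) (hg : ∀ N, 0 ≤ N → g N ≤ γ * N)
    {ψ : EuclideanSpace ℝ (Fin n) → ℝ} (hψ : ContDiff ℝ 2 ψ) (hpos : ∀ x ∈ closure Ω, 0 < ψ x)
    (hsup : ∀ x ∈ Ω, d * lap ψ x - (∑ i, a x i * pd ψ i x) + μ * ψ x < 0)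
    (sol : ImpSol n Ω d a f g) (m : ℕ) {C : ℝ} (hC : 0 ≤ C)
    (h0 : ∀ x ∈ closure Ω, sol.N m x ≤ C * ψ x) :
    ∀ x ∈ closure Ω, sol.N (m+1) x ≤ (γ * Real.exp (r - μ) * C) * ψ x := by
  set S := closure Ω ×ˢ Set.Icc (0:ℝ) 1 with hS
  have hK : IsCompact (closure Ω) := hbdd.isCompact_closure
  have hSc : IsCompact S := hK.prod isCompact_Icc
  obtain ⟨x1, hx1⟩ := hne
  have hSne : S.Nonempty := ⟨(x1, 0), subset_closure hx1, by simp⟩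
  set q : EuclideanSpace ℝ (Fin n) × ℝ → ℝ :=
    fun p => sol.u m p.1 p.2 * Real.exp (-(r - μ) * p.2) / ψ p.1 with hq
  have hqc : ContinuousOn q S := by
    apply ContinuousOn.div
    · exact (sol.u_cont m).mul (by fun_prop)
    · exact (hψ.continuous.comp continuous_fst).continuousOn
    · intro p hp; exact (hpos _ hp.1).ne'
  obtain ⟨⟨x0, t0⟩, hmem, hmax⟩ := hSc.exists_isMaxOn hSne hqc
  have hinit : ∀ x ∈ closure Ω, sol.u m x 0 ≤ γ * C * ψ x := by
    intro x hx
    have hcl : IsClosed {x | x ∈ closure Ω ∧ sol.u m x 0 ≤ γ * C * ψ x} := by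
      apply IsClosed.isClosed_le isClosed_closure
      · exact (sol.u_cont m).comp (f := fun x => (x, (0:ℝ))) (by fun_prop)
          (fun x hx => ⟨hx, by simp⟩)
      · exact (continuous_const.mul hψ.continuous).continuousOn
    have hsub : Ω ⊆ {x | x ∈ closure Ω ∧ sol.u m x 0 ≤ γ * C * ψ x} := by
      intro y hy
      have hyc := subset_closure hy
      refine ⟨hyc, ?_⟩
      rw [sol.init m y hy]
      calc g (sol.N m y) ≤ γ * sol.N m y := hg _ (sol.N_nonneg m y hyc)
        _ ≤ γ * (C * ψ y) := by gcongr; exact h0 y hyc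
        _ = _ := by ring
    exact ((hcl.closure_subset_iff.2 hsub) hx).2
  have hmain : q (x0, t0) ≤ γ * C := by
    by_contra! hlt
    have hx0 := hmem.1
    have ht0 := hmem.2
    have hp0 := hpos x0 hx0
    have hu0 : 0 < sol.u m x0 t0 := by
      have hqpos : 0 < q (x0, t0) := lt_of_le_of_lt (by positivity) hlt
      by_contra! hle
      have : q (x0, t0) ≤ 0 := by
        apply div_nonpos_of_nonpos_of_nonneg _ hp0.le
        exact mul_nonpos_of_nonpos_of_nonneg hle (Real.exp_pos _).le
      linarith
    have htpos : 0 < t0 := by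
      rcases ht0.1.lt_or_eq with h | h
      · exact h
      · exfalso
        simp only at h
        have := hinit x0 hx0
        rw [← h] at hlt
        simp only [hq, mul_zero, Real.exp_zero, mul_one] at hlt
        rw [lt_div_iff₀ hp0] at hlt
        linarith
    have htIoc : t0 ∈ Set.Ioc (0:ℝ) 1 := ⟨htpos, ht0.2⟩
    have hxΩ : x0 ∈ Ω := by
      by_contra hnot
      have : x0 ∈ frontier Ω := by
        rw [hopen.frontier_eq]; exact ⟨hx0, hnot⟩
      have := sol.bdry m x0 this t0 htIoc
      linarith
    set Q := q (x0, t0) with hQ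
    set Q' := Q * Real.exp ((r - μ) * t0) with hQ'
    have hQeq : sol.u m x0 t0 = Q' * ψ x0 := by
      rw [hQ', hQ]; simp only [hq]
      field_simp
      rw [← Real.exp_add]; simp
    have hQ'pos : 0 < Q' := by
      by_contra! h
      nlinarith
    -- space
    have hloc : IsLocalMax (fun y => sol.u m y t0 + (-Q') * ψ y) x0 := by
      filter_upwards [hopen.mem_nhds hxΩ] with y hy
      have hyc := subset_closure hy
      have h1 : q (y, t0) ≤ Q := hmax (show (y, t0) ∈ S from ⟨hyc, ht0⟩)
      simp only [hq] at h1
      rw [div_le_iff₀ (hpos y hyc)] at h1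
      have h2 : sol.u m y t0 ≤ Q' * ψ y := by
        have h3 := mul_le_mul_of_nonneg_right h1 (Real.exp_pos ((r - μ) * t0)).le
        rw [mul_assoc, ← Real.exp_add, show -(r - μ) * t0 + (r - μ) * t0 = 0 by ring,
          Real.exp_zero] at h3
        rw [hQ']; linarith
      rw [hQeq]; linarith
    have hu2 := sol.u_space_C2 m t0 htIoc x0 hxΩ
    have hψ2 : ContDiffAt ℝ 2 ψ x0 := hψ.contDiffAt
    have hc2 : ContDiffAt ℝ 2 (fun y => sol.u m y t0 + (-Q') * ψ y) x0 :=
      hu2.add (contDiffAt_const.mul hψ2)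
    have hlap := lap_localMax hc2 hloc
    rw [lap_add_smul _ hu2 hψ2] at hlap
    have hpd : ∀ i, pd (fun y => sol.u m y t0) i x0 = Q' * pd ψ i x0 := by
      intro i
      have := pd_localMax hloc i
      rw [pd_add_smul _ (hu2.differentiableAt (by norm_num)) (hψ2.differentiableAt (by norm_num))]
        at this
      linarith
    -- time
    have htime : (r - μ) * sol.u m x0 t0 ≤ deriv (fun s => sol.u m x0 s) t0 := by
      by_contra! hlt2
      have hder := ((sol.u_time_C1 m x0 hxΩ t0 htIoc).differentiableAt (by norm_num)).hasDerivAt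
      have hexp : HasDerivAt (fun s : ℝ => Real.exp (-(r - μ) * s))
          (Real.exp (-(r - μ) * t0) * (-(r-μ))) t0 := by
        simpa using ((hasDerivAt_id t0).const_mul (-(r-μ))).exp
      have hprod := hder.mul hexp
      set D := deriv (fun s => sol.u m x0 s) t0
      have hneg : D * Real.exp (-(r - μ) * t0) +
          sol.u m x0 t0 * (Real.exp (-(r - μ) * t0) * (-(r-μ))) < 0 := by
        have : 0 < Real.exp (-(r - μ) * t0) := Real.exp_pos _
        nlinarith
      have hsl := hasDerivAt_iff_tendsto_slope.1 hprod
      have hev : ∀ᶠ s in 𝓝[<] t0, slope ((fun s => sol.u m x0 s) * fun s : ℝ => Real.exp (-(r - μ) * s)) t0 s < 0 :=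
        (hsl.eventually (gt_mem_nhds hneg)).filter_mono
          (nhdsWithin_mono _ (fun s (hs : s < t0) => hs.ne))
      have hev2 : ∀ᶠ s in 𝓝[<] t0, s ∈ Set.Ioo 0 t0 := Ioo_mem_nhdsLT htpos
      obtain ⟨s, hs1, hs2⟩ := (hev.and hev2).exists
      have h1 : q (x0, s) ≤ Q := hmax (show (x0, s) ∈ S from ⟨hx0, hs2.1.le, hs2.2.le.trans ht0.2⟩)
      rw [hQ] at h1
      simp only [hq] at h1
      rw [div_le_div_iff_of_pos_right hp0] at h1
      rw [slope_def_field, div_neg_iff] at hs1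
      simp only [Pi.mul_apply] at hs1
      rcases hs1 with h | h
      · linarith [h.1]
      · linarith [h.2, hs2.2]
    have hpde := sol.pde m x0 hxΩ t0 htIoc
    simp_rw [hpd] at hpde
    have hsum : ∑ i, a x0 i * (Q' * pd ψ i x0) = Q' * ∑ i, a x0 i * pd ψ i x0 := by
      rw [Finset.mul_sum]; exact Finset.sum_congr rfl fun i _ => by ring
    rw [hsum] at hpde
    have hs := mul_lt_mul_of_pos_left (hsup x0 hxΩ) hQ'pos
    have hff := hf _ hu0.le
    have hdl := mul_le_mul_of_nonneg_left hlap hd.le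
    rw [hpde] at htime
    rw [hQeq] at htime hff
    nlinarith
  intro x hx
  have h1 : q (x, 1) ≤ γ * C := (hmax (show (x, (1:ℝ)) ∈ S from ⟨hx, by simp⟩)).trans hmain
  simp only [hq] at h1
  rw [div_le_iff₀ (hpos x hx)] at h1
  rw [sol.recur m x hx]
  have h3 := mul_le_mul_of_nonneg_right h1 (Real.exp_pos (r - μ)).le
  rw [mul_assoc, ← Real.exp_add] at h3
  simp at h3
  linarith

lemma extinction_of_super {d : ℝ} (hd : 0 < d) {Ω : Set (EuclideanSpace ℝ (Fin n))}
    (hopen : IsOpen Ω)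
    (hne : Ω.Nonempty) (hbdd : Bornology.IsBounded Ω)
    {a : EuclideanSpace ℝ (Fin n) → EuclideanSpace ℝ (Fin n)} {f g : ℝ → ℝ} {r γ μ : ℝ}
    (hf : ∀ N, 0 ≤ N → f N ≤ r * N) (hγ : 0 < γ) (hg : ∀ N, 0 ≤ N → g N ≤ γ * N)
    (hμ : r + Real.log γ < μ)
    {ψ : EuclideanSpace ℝ (Fin n) → ℝ} (hψ : ContDiff ℝ 2 ψ) (hpos : ∀ x ∈ closure Ω, 0 < ψ x)
    (hsup : ∀ x ∈ Ω, d * lap ψ x - (∑ i, a x i * pd ψ i x) + μ * ψ x < 0)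
    (sol : ImpSol n Ω d a f g) :
    ∀ x ∈ Ω, Tendsto (fun m => sol.N m x) atTop (𝓝 0) := by
  have hK : IsCompact (closure Ω) := hbdd.isCompact_closure
  obtain ⟨C0, hC0⟩ : ∃ C0, ∀ x ∈ closure Ω, sol.N 0 x / ψ x ≤ C0 := by
    have hc : ContinuousOn (fun x => sol.N 0 x / ψ x) (closure Ω) :=
      (sol.N_cont 0).div hψ.continuous.continuousOn fun x hx => (hpos x hx).ne'
    obtain ⟨C0, h⟩ := (hK.image_of_continuousOn hc).bddAbove
    exact ⟨C0, fun x hx => h ⟨x, hx, rfl⟩⟩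
  set C := max C0 0
  set ρ := γ * Real.exp (r - μ)
  have hρ0 : 0 < ρ := by positivity
  have hρ1 : ρ < 1 := by
    have : ρ = Real.exp (Real.log γ + (r - μ)) := by
      rw [Real.exp_add, Real.exp_log hγ]
    rw [this, Real.exp_lt_one_iff]; linarith
  have key : ∀ m, ∀ x ∈ closure Ω, sol.N m x ≤ (ρ ^ m * C) * ψ x := by
    intro m
    induction m with
    | zero =>
      intro x hx
      have := hC0 x hx
      rw [div_le_iff₀ (hpos x hx)] at this
      have h2 : C0 * ψ x ≤ C * ψ x := by
        gcongr
        · exact (hpos x hx).le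
        · exact le_max_left _ _
      simpa using this.trans h2
    | succ m ih =>
      intro x hx
      have := comparison hd hopen hne hbdd hf hγ hg hψ hpos hsup sol m
        (C := ρ ^ m * C) (by positivity) ih x hx
      calc _ ≤ _ := this
        _ = _ := by rw [pow_succ]; ring
  intro x hx
  have hxc := subset_closure hx
  refine squeeze_zero (fun m => sol.N_nonneg m x hxc) (fun m => key m x hxc) ?_
  have := (tendsto_pow_atTop_nhds_zero_of_lt_one hρ0.le hρ1).mul_const C |>.mul_const (ψ x)
  simpa using this

lemma chart {Ω : Set (EuclideanSpace ℝ (Fin n))} (hbd : HasCkBoundary ⊤ Ω)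
    {p : EuclideanSpace ℝ (Fin n)} (hp : p ∈ frontier Ω) :
    ∃ δ > 0, ∃ c > 0, ∃ C' ≥ 0, ∃ v : EuclideanSpace ℝ (Fin n),
      ∃ φ : EuclideanSpace ℝ (Fin n) → ℝ,
      (∀ x ∈ Metric.ball p δ, ∀ σ : ℝ, 0 ≤ σ → x + σ • v ∈ Metric.ball p δ →
        φ (x + σ • v) ≤ φ x - c * σ) ∧
      (∀ x ∈ Metric.ball p δ, ∀ y ∈ Metric.ball p δ, |φ x - φ y| ≤ C' * ‖x - y‖) ∧
      (∀ y ∈ Metric.ball p δ, (y ∈ Ω ↔ φ y < 0)) ∧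
      (∀ y ∈ Metric.ball p δ, y ∈ frontier Ω → φ y = 0) := by
  obtain ⟨U, φ, hU, hpU, hφ, hφ', hΩ, hfr⟩ := hbd p hp
  have hst : HasStrictFDerivAt φ (fderiv ℝ φ p) p :=
    (hφ.contDiffAt (hU.mem_nhds hpU)).hasStrictFDerivAt (by simp)
  set A := fderiv ℝ φ p
  obtain ⟨v, hv⟩ : ∃ v, A v < 0 := by
    have := hφ' p hpU
    obtain ⟨w, hw⟩ : ∃ w, A w ≠ 0 := by
      by_contra! h; exact this (ContinuousLinearMap.ext h)
    rcases lt_or_gt_of_ne hw with h | h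
    · exact ⟨w, h⟩
    · exact ⟨-w, by simpa using h⟩
  have hv0 : v ≠ 0 := by rintro rfl; simp at hv
  have hvn : 0 < ‖v‖ := norm_pos_iff.2 hv0
  set c := -(A v) / 2 with hc
  have hcpos : 0 < c := by rw [hc]; linarith
  set ε := c / ‖v‖ with hε
  have hεpos : 0 < ε := by positivity
  have h1 := hst.isLittleO.def hεpos
  rw [nhds_prod_eq] at h1
  obtain ⟨W, hW, hW2⟩ := (Filter.eventually_prod_self_iff (r := fun x y : EuclideanSpace ℝ (Fin n) => ‖φ x - φ y - A (x - y)‖ ≤ ε * ‖x - y‖)).1 h1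
  obtain ⟨δ, hδ, hball⟩ := Metric.mem_nhds_iff.1 (inter_mem (hU.mem_nhds hpU) hW)
  have key : ∀ x ∈ Metric.ball p δ, ∀ y ∈ Metric.ball p δ, |φ x - φ y - A (x - y)| ≤ ε * ‖x - y‖ := by
    intro x hx y hy
    exact hW2 x (hball hx).2 y (hball hy).2
  refine ⟨δ, hδ, c, hcpos, ‖A‖ + ε, by positivity, v, φ, ?_, ?_, ?_, ?_⟩
  · intro x hx σ hσ hxσ
    have := (abs_le.1 (key _ hxσ x hx)).2
    simp only [add_sub_cancel_left, map_smul, smul_eq_mul, norm_smul, Real.norm_eq_abs,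
      abs_of_nonneg hσ] at this
    have e1 : ε * (σ * ‖v‖) = c * σ := by rw [hε]; field_simp
    have e2 : A v = -2 * c := by rw [hc]; ring
    rw [e1, e2] at this
    linarith
  · intro x hx y hy
    have h1 := key x hx y hy
    have h2 := A.le_opNorm (x - y)
    rw [Real.norm_eq_abs] at h2
    calc |φ x - φ y| = |(φ x - φ y - A (x - y)) + A (x - y)| := by ring_nf
      _ ≤ _ := abs_add_le _ _
      _ ≤ _ := by linarith
  · intro y hy
    have hyU := (hball hy).1
    constructor
    · intro h
      have : y ∈ Ω ∩ U := ⟨h, hyU⟩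
      rw [hΩ] at this; exact this.2
    · intro h
      have : y ∈ {y ∈ U | φ y < 0} := ⟨hyU, h⟩
      rw [← hΩ] at this; exact this.1
  · intro y hy h
    have : y ∈ frontier Ω ∩ U := ⟨h, (hball hy).1⟩
    rw [hfr] at this; exact this.2

open scoped Pointwise in
lemma frontier_null {Ω : Set (EuclideanSpace ℝ (Fin n))} (hbd : HasCkBoundary ⊤ Ω) :
    volume (frontier Ω) = 0 := by
  apply measure_null_of_locally_null
  intro p hp
  obtain ⟨δ, hδ, c, hc, C', -, v, φ, h1, -, -, h4⟩ := chart hbd hp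
  refine ⟨frontier Ω ∩ Metric.ball p δ, inter_mem self_mem_nhdsWithin
    (mem_nhdsWithin_of_mem_nhds (Metric.ball_mem_nhds p hδ)), ?_⟩
  apply Measure.addHaar_eq_zero_of_disjoint_translates volume
    (fun k : ℕ => (1 / ((k:ℝ) + 1)) • v)
  · apply Metric.isBounded_range_of_tendsto (x := (0:ℝ) • v)
    exact tendsto_one_div_add_atTop_nhds_zero_nat.smul_const v
  · have key : ∀ k l : ℕ, k < l → Disjoint (({(1 / ((k:ℝ) + 1)) • v} : Set (EuclideanSpace ℝ (Fin n))) + (frontier Ω ∩ Metric.ball p δ))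
        (({(1 / ((l:ℝ) + 1)) • v} : Set (EuclideanSpace ℝ (Fin n))) + (frontier Ω ∩ Metric.ball p δ)) := by
      intro k l hkl
      rw [Set.disjoint_left]
      intro z hz1 hz2
      rw [Set.singleton_add] at hz1 hz2
      obtain ⟨x, hx, rfl⟩ := hz1
      obtain ⟨y, hy, hxy⟩ := hz2
      have hlt : (1 / ((l:ℝ) + 1)) < 1 / ((k:ℝ) + 1) := by
        apply one_div_lt_one_div_of_lt (by positivity)
        have : (k:ℝ) < l := by exact_mod_cast hkl
        linarith
      have hy' : y = x + (1 / ((k:ℝ) + 1) - 1 / ((l:ℝ) + 1)) • v := by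
        rw [sub_smul]; simp only at hxy
        have : y = (1 / ((k:ℝ) + 1)) • v + x - (1 / ((l:ℝ) + 1)) • v := by rw [← hxy]; abel
        rw [this]; abel
      have := h1 x hx.2 (1 / ((k:ℝ) + 1) - 1 / ((l:ℝ) + 1)) (by linarith) (hy' ▸ hy.2)
      rw [← hy', h4 y hy.2 hy.1, h4 x hx.2 hx.1] at this
      nlinarith
    intro k l hkl
    rcases lt_or_gt_of_ne hkl with h | h
    · exact key k l h
    · exact (key l k h).symm
  · exact isClosed_frontier.measurableSet.inter measurableSet_ball

lemma lip_local {Ω : Set (EuclideanSpace ℝ (Fin n))} (hopen : IsOpen Ω) (hbd : HasCkBoundary ⊤ Ω)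
    {a : EuclideanSpace ℝ (Fin n) → EuclideanSpace ℝ (Fin n)}
    (ha : ContDiffOn ℝ 1 a (closure Ω)) : LocallyLipschitzOn (closure Ω) a := by
  intro p hp
  by_cases hpΩ : p ∈ Ω
  · have : ContDiffAt ℝ 1 a p := (ha.contDiffAt (mem_of_superset (hopen.mem_nhds hpΩ) subset_closure))
    obtain ⟨K, t, ht, hK⟩ := this.exists_lipschitzOnWith
    exact ⟨K, t, mem_nhdsWithin_of_mem_nhds ht, hK⟩
  have hpf : p ∈ frontier Ω := by rw [hopen.frontier_eq]; exact ⟨hp, hpΩ⟩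
  obtain ⟨δ, hδ, c, hc, C', hC', v, φ, h1, h2, h3, -⟩ := chart hbd hpf
  -- bound on derivative
  obtain ⟨δ1, hδ1, B, hB0, hB⟩ : ∃ δ1 > 0, ∃ B ≥ (0:ℝ), ∀ y ∈ Metric.ball p δ1 ∩ Ω,
      ∃ A : EuclideanSpace ℝ (Fin n) →L[ℝ] EuclideanSpace ℝ (Fin n), HasFDerivAt a A y ∧ ‖A‖ ≤ B := by
    have hcd := ha p hp
    have h01 : (1 : WithTop ℕ∞) = 0 + 1 := by norm_num
    rw [h01, contDiffWithinAt_succ_iff_hasFDerivWithinAt (by simp)] at hcd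
    obtain ⟨u, hu, -, f', hf', hf'c⟩ := hcd
    rw [Set.insert_eq_of_mem hp] at hu
    have hcont := hf'c.continuousWithinAt
    have hev : ∀ᶠ y in 𝓝[u] p, ‖f' y‖ < ‖f' p‖ + 1 :=
      hcont.norm.eventually (gt_mem_nhds (by linarith))
    rw [eventually_nhdsWithin_iff] at hev
    obtain ⟨W, hW, hWu⟩ := mem_nhdsWithin_iff_exists_mem_nhds_inter.1 hu
    obtain ⟨δ1, hδ1, hb⟩ := Metric.mem_nhds_iff.1 (inter_mem hev hW)
    refine ⟨δ1, hδ1, ‖f' p‖ + 1, by positivity, fun y hy => ⟨f' y, ?_, ?_⟩⟩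
    · have hyu : y ∈ u := hWu ⟨(hb hy.1).2, subset_closure hy.2⟩
      apply (hf' y hyu).hasFDerivAt
      filter_upwards [Metric.isOpen_ball.mem_nhds hy.1, hopen.mem_nhds hy.2] with z hz1 hz2
      exact hWu ⟨(hb hz1).2, subset_closure hz2⟩
    · have hyu : y ∈ u := hWu ⟨(hb hy.1).2, subset_closure hy.2⟩
      exact ((hb hy.1).1 hyu).le
  set δ2 := min δ δ1 with hδ2
  have hδ2pos : 0 < δ2 := lt_min hδ hδ1
  have seg : ∀ x y, segment ℝ x y ⊆ Metric.ball p δ2 ∩ Ω → ‖a y - a x‖ ≤ B * ‖y - x‖ := by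
    intro x y hs
    have hc := convex_segment (𝕜 := ℝ) x y
    choose! A hA hAB using hB
    refine hc.norm_image_sub_le_of_norm_hasFDerivWithin_le (f' := A) (fun z hz => ?_) (fun z hz => ?_)
      (left_mem_segment ℝ x y) (right_mem_segment ℝ x y)
    · have := hs hz
      exact (hA z ⟨Metric.ball_subset_ball (min_le_right _ _) this.1, this.2⟩).hasFDerivWithinAt
    · have := hs hz
      exact (hAB z ⟨Metric.ball_subset_ball (min_le_right _ _) this.1, this.2⟩)
  set κ := C' / c with hκ
  have hκ0 : 0 ≤ κ := by positivity
  set δ3 := δ2 / (3 + 2 * κ * ‖v‖) with hδ3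
  have hden : 0 < 3 + 2 * κ * ‖v‖ := by positivity
  have hδ3pos : 0 < δ3 := by positivity
  have hδ3eq : δ3 * (3 + 2 * κ * ‖v‖) = δ2 := by rw [hδ3]; field_simp
  have main : ∀ x ∈ Metric.ball p δ3 ∩ Ω, ∀ y ∈ Metric.ball p δ3 ∩ Ω,
      ‖a y - a x‖ ≤ (B * (1 + 2 * κ * ‖v‖)) * ‖y - x‖ := by
    intro x hx y hy
    set s := κ * ‖y - x‖ with hs
    have hs0 : 0 ≤ s := by positivity
    have hxp := mem_ball_iff_norm.1 hx.1
    have hyp := mem_ball_iff_norm.1 hy.1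
    have hyx : ‖y - x‖ < 2 * δ3 := by
      calc ‖y - x‖ = ‖(y - p) - (x - p)‖ := by congr 1; abel
        _ ≤ ‖y - p‖ + ‖x - p‖ := norm_sub_le _ _
        _ < _ := by linarith
    -- general membership
    have mem : ∀ σ θ : ℝ, 0 ≤ σ → σ ≤ s → 0 ≤ θ → θ ≤ 1 →
        x + θ • (y - x) + σ • v ∈ Metric.ball p δ2 := by
      intro σ θ hσ hσs hθ hθ1
      rw [mem_ball_iff_norm]
      have hsv : s * ‖v‖ ≤ 2 * δ3 * κ * ‖v‖ := by
        rw [hs]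
        have := mul_le_mul_of_nonneg_left hyx.le hκ0
        nlinarith [norm_nonneg v]
      calc ‖x + θ • (y - x) + σ • v - p‖ = ‖(x - p) + θ • (y - x) + σ • v‖ := by congr 1; abel
        _ ≤ ‖x - p‖ + ‖θ • (y - x)‖ + ‖σ • v‖ := norm_add₃_le
        _ = ‖x - p‖ + θ * ‖y - x‖ + σ * ‖v‖ := by
          rw [norm_smul, norm_smul, Real.norm_of_nonneg hθ, Real.norm_of_nonneg hσ]
        _ ≤ ‖x - p‖ + 1 * ‖y - x‖ + s * ‖v‖ := by gcongr
        _ < δ2 := by nlinarith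
    have sub1 : Metric.ball p δ2 ⊆ Metric.ball p δ := Metric.ball_subset_ball (min_le_left _ _)
    have vert : ∀ z ∈ Metric.ball p δ2 ∩ Ω, (∀ σ, 0 ≤ σ → σ ≤ s → z + σ • v ∈ Metric.ball p δ2) →
        segment ℝ z (z + s • v) ⊆ Metric.ball p δ2 ∩ Ω := by
      intro z hz hzs w hw
      rw [segment_eq_image'] at hw
      obtain ⟨θ, hθ, rfl⟩ := hw
      have e : z + θ • (z + s • v - z) = z + (θ * s) • v := by
        rw [add_sub_cancel_left, smul_smul]
      simp only [e]
      have h0 : 0 ≤ θ * s := mul_nonneg hθ.1 hs0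
      have hm := hzs (θ * s) h0 (by nlinarith [hθ.2])
      refine ⟨hm, (h3 _ (sub1 hm)).2 ?_⟩
      have hz0 := (h3 z (sub1 hz.1)).1 hz.2
      have := h1 z (sub1 hz.1) _ h0 (sub1 hm)
      nlinarith
    have hx2 : x ∈ Metric.ball p δ2 := by simpa using mem 0 0 le_rfl hs0 le_rfl zero_le_one
    have hy2 : y ∈ Metric.ball p δ2 := by simpa using mem 0 1 le_rfl hs0 zero_le_one le_rfl
    have s1 := seg _ _ (vert x ⟨hx2, hx.2⟩ (fun σ h h' => by simpa using mem σ 0 h h' le_rfl zero_le_one))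
    have s2 := seg _ _ (vert y ⟨hy2, hy.2⟩ (fun σ h h' => by simpa using mem σ 1 h h' zero_le_one le_rfl))
    have s3 := seg (x + s • v) (y + s • v) (by
      intro w hw
      rw [segment_eq_image'] at hw
      obtain ⟨θ, hθ, rfl⟩ := hw
      have e : x + s • v + θ • (y + s • v - (x + s • v)) = x + θ • (y - x) + s • v := by
        rw [add_sub_add_right_eq_sub]; abel
      simp only [e]
      have hm := mem s θ hs0 le_rfl hθ.1 hθ.2
      have hm0 := mem 0 θ le_rfl hs0 hθ.1 hθ.2
      rw [zero_smul, add_zero] at hm0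
      refine ⟨hm, (h3 _ (sub1 hm)).2 ?_⟩
      have hx0 := (h3 x (sub1 hx2)).1 hx.2
      have k1 := h1 _ (sub1 hm0) s hs0 (sub1 hm)
      have k2 := (abs_le.1 (h2 _ (sub1 hm0) x (sub1 hx2))).2
      rw [add_sub_cancel_left, norm_smul, Real.norm_of_nonneg hθ.1] at k2
      have k3 : C' * (θ * ‖y - x‖) ≤ C' * (1 * ‖y - x‖) := by
        gcongr; exact hθ.2
      have k4 : c * s = C' * ‖y - x‖ := by rw [hs, hκ]; field_simp
      linarith)
    rw [add_sub_cancel_left, norm_smul, Real.norm_of_nonneg hs0] at s1 s2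
    rw [add_sub_add_right_eq_sub] at s3
    calc ‖a y - a x‖ = ‖-(a (y + s • v) - a y) + (a (y + s • v) - a (x + s • v)) + (a (x + s • v) - a x)‖ := by
          congr 1; abel
      _ ≤ ‖-(a (y + s • v) - a y)‖ + ‖a (y + s • v) - a (x + s • v)‖ + ‖a (x + s • v) - a x‖ := norm_add₃_le
      _ ≤ B * (s * ‖v‖) + B * ‖y - x‖ + B * (s * ‖v‖) := by rw [norm_neg]; gcongr
      _ = _ := by rw [hs]; ring
  have hL : LipschitzOnWith (Real.toNNReal (B * (1 + 2 * κ * ‖v‖))) a (Metric.ball p δ3 ∩ Ω) := by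
    apply LipschitzOnWith.of_dist_le_mul
    intro x hx y hy
    rw [Real.coe_toNNReal _ (by positivity), dist_eq_norm, dist_eq_norm]
    exact main y hy x hx
  refine ⟨Real.toNNReal (B * (1 + 2 * κ * ‖v‖)), Metric.ball p δ3 ∩ closure Ω, inter_mem (mem_nhdsWithin_of_mem_nhds
    (Metric.ball_mem_nhds p hδ3pos)) self_mem_nhdsWithin, ?_⟩
  have hcl : closure (Metric.ball p δ3 ∩ Ω) ⊆ closure Ω := closure_mono Set.inter_subset_right
  exact (LipschitzOnWith.closure (ha.continuousOn.mono hcl) hL).mono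
    (Metric.isOpen_ball.inter_closure)

/-- The elliptic operator. -/
def Lop (d μ : ℝ) (a : EuclideanSpace ℝ (Fin n) → EuclideanSpace ℝ (Fin n))
    (ψ : EuclideanSpace ℝ (Fin n) → ℝ) (x : EuclideanSpace ℝ (Fin n)) : ℝ :=
  d * lap ψ x - (∑ i, a x i * pd ψ i x) + μ * ψ x

lemma Lop_add_smul {d μ : ℝ} {a : EuclideanSpace ℝ (Fin n) → EuclideanSpace ℝ (Fin n)}
    {u v : EuclideanSpace ℝ (Fin n) → ℝ} (c : ℝ) (hu : ContDiff ℝ 2 u) (hv : ContDiff ℝ 2 v)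
    (x : EuclideanSpace ℝ (Fin n)) :
    Lop d μ a (fun y => u y + c * v y) x = Lop d μ a u x + c * Lop d μ a v x := by
  unfold Lop
  rw [lap_add_smul c hu.contDiffAt hv.contDiffAt]
  simp_rw [pd_add_smul c (hu.differentiable (by norm_num) x) (hv.differentiable (by norm_num) x)]
  have : ∑ i, a x i * (pd u i x + c * pd v i x) = (∑ i, a x i * pd u i x) + c * ∑ i, a x i * pd v i x := by
    rw [Finset.mul_sum, ← Finset.sum_add_distrib]
    refine Finset.sum_congr rfl fun i _ => by ring
  rw [this]; ring

lemma Lop_cont {d μ : ℝ} {a : EuclideanSpace ℝ (Fin n) → EuclideanSpace ℝ (Fin n)}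
    (ha : Continuous a) {u : EuclideanSpace ℝ (Fin n) → ℝ} (hu : ContDiff ℝ 2 u) :
    Continuous (Lop d μ a u) := by
  have hp : ∀ i, ContDiff ℝ 1 (fun y => pd u i y) := fun i =>
    (hu.fderiv_right (m := 1) (by norm_num)).clm_apply contDiff_const
  have hp2 : ∀ i, Continuous (fun y => pd2 u i i y) := fun i =>
    ((hp i).continuous_fderiv (by norm_num)).clm_apply continuous_const
  unfold Lop lap
  have h1 := fun i => (hp i).continuous
  have h2 := hu.continuous
  have h3 : ∀ i, Continuous fun x => a x i := fun i => by fun_prop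
  fun_prop

lemma exists_measure {d μ : ℝ} {a : EuclideanSpace ℝ (Fin n) → EuclideanSpace ℝ (Fin n)}
    (ha : Continuous a) {K : Set (EuclideanSpace ℝ (Fin n))} (hK : IsCompact K) (hne : K.Nonempty)
    (hno : ¬ ∃ ψ : EuclideanSpace ℝ (Fin n) → ℝ, ContDiff ℝ 2 ψ ∧ (∀ x, 0 ≤ ψ x) ∧
      ∀ x ∈ K, Lop d μ a ψ x < 0) :
    ∃ ν : Measure (EuclideanSpace ℝ (Fin n)), IsFiniteMeasure ν ∧ ν ≠ 0 ∧ ν Kᶜ = 0 ∧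
      ∀ ψ : EuclideanSpace ℝ (Fin n) → ℝ, ContDiff ℝ 2 ψ → (∀ x, 0 ≤ ψ x) →
        0 ≤ ∫ x, Lop d μ a ψ x ∂ν := by
  haveI : CompactSpace K := isCompact_iff_compactSpace.1 hK
  haveI : Nonempty K := hne.to_subtype
  let R : ∀ ψ : EuclideanSpace ℝ (Fin n) → ℝ, ContDiff ℝ 2 ψ → C(K, ℝ) := fun ψ h =>
    ⟨fun x => Lop d μ a ψ x, (Lop_cont ha h).comp continuous_subtype_val⟩
  let A : Set C(K, ℝ) := {F | ∀ x, F x < 0}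
  let B : Set C(K, ℝ) := {F | ∃ ψ : EuclideanSpace ℝ (Fin n) → ℝ, ContDiff ℝ 2 ψ ∧ (∀ x, 0 ≤ ψ x) ∧
      ∀ x : K, F x = Lop d μ a ψ x}
  have hAc : Convex ℝ A := by
    intro F hF G hG s t hs ht hst x
    have h1 := hF x
    have h2 := hG x
    simp only [ContinuousMap.add_apply, ContinuousMap.smul_apply, smul_eq_mul]
    rcases hs.eq_or_lt with h | h
    · have : t = 1 := by linarith
      rw [← h, this]; linarith
    · nlinarith
  have hAo : IsOpen A := by
    have : A = {F : C(K, ℝ) | Set.MapsTo F Set.univ (Set.Iio 0)} := by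
      ext F; simp [A, Set.MapsTo]
    rw [this]
    exact ContinuousMap.isOpen_setOf_mapsTo isCompact_univ isOpen_Iio
  have hLz : ∀ x, Lop d μ a (fun _ => 0) x = 0 := by
    intro x
    have := Lop_add_smul (d := d) (μ := μ) (a := a) (u := fun _ => 0) (v := fun _ => 0) 1
      contDiff_const contDiff_const x
    simp only [mul_zero, add_zero, one_mul] at this
    linarith
  have hBs : ∀ F ∈ B, ∀ G ∈ B, ∀ t : ℝ, 0 ≤ t → F + t • G ∈ B := by
    rintro F ⟨u, hu, hu0, hF⟩ G ⟨v, hv, hv0, hG⟩ t ht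
    refine ⟨fun y => u y + t * v y, hu.add (contDiff_const.mul hv), fun x => add_nonneg (hu0 x) (mul_nonneg ht (hv0 x)), fun x => ?_⟩
    rw [Lop_add_smul t hu hv]
    simp [hF, hG]
  have hB0 : (0 : C(K, ℝ)) ∈ B := ⟨fun _ => 0, contDiff_const, fun _ => le_rfl, fun x => (hLz x).symm⟩
  have hBt : ∀ G ∈ B, ∀ t : ℝ, 0 ≤ t → t • G ∈ B := fun G hG t ht => by
    simpa using hBs 0 hB0 G hG t ht
  have hBc : Convex ℝ B := fun F hF G hG s t hs ht _ => hBs _ (hBt F hF s hs) G hG t ht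
  have hdis : Disjoint A B := by
    rw [Set.disjoint_left]
    rintro F hF ⟨ψ, h1, h2, h3⟩
    exact hno ⟨ψ, h1, h2, fun x hx => by rw [← h3 ⟨x, hx⟩]; exact hF ⟨x, hx⟩⟩
  obtain ⟨ℓ, u, hℓA, hℓB⟩ := geometric_hahn_banach_open hAc hAo hBc hdis
  have hu0 : u ≤ 0 := by simpa using hℓB 0 hB0
  have hBpos : ∀ F ∈ B, 0 ≤ ℓ F := by
    intro F hF
    by_contra! h
    have := hℓB _ (hBt F hF ((u - 1) / ℓ F) (div_nonneg_of_nonpos (by linarith) h.le))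
    rw [map_smul, smul_eq_mul, div_mul_cancel₀ _ h.ne] at this
    linarith
  have h1pos : 0 < ℓ 1 := by
    have := hℓA (-1) (fun x => by simp)
    rw [map_neg] at this; linarith
  have hpos : ∀ F : C(K, ℝ), (∀ x, 0 ≤ F x) → 0 ≤ ℓ F := by
    intro F hF
    apply le_of_forall_pos_le_add
    intro ε hε
    have := hℓA (-F - (ε / ℓ 1) • 1) (fun x => by
      have := hF x
      have h2 : 0 < ε / ℓ 1 := by positivity
      simp; linarith)
    rw [map_sub, map_neg, map_smul, smul_eq_mul, div_mul_cancel₀ _ h1pos.ne'] at this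
    linarith
  let Λ : CompactlySupportedContinuousMap K ℝ →ₚ[ℝ] ℝ := PositiveLinearMap.mk₀
    { toFun := fun F => ℓ F.toContinuousMap
      map_add' := fun F G => by rw [← map_add]; rfl
      map_smul' := fun c F => by rw [← map_smul]; rfl }
    (fun F hF => hpos _ (fun x => hF x))
  have hΛ : ∀ F : C(K, ℝ), ∫ x, F x ∂(RealRMK.rieszMeasure Λ) = ℓ F := fun F =>
    RealRMK.integral_rieszMeasure Λ (CompactlySupportedContinuousMap.continuousMapEquiv F)
  have hme : MeasurableEmbedding (Subtype.val : K → EuclideanSpace ℝ (Fin n)) :=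
    MeasurableEmbedding.subtype_coe hK.measurableSet
  refine ⟨(RealRMK.rieszMeasure Λ).map Subtype.val, inferInstance, ?_, ?_, ?_⟩
  · intro h
    rw [Measure.map_eq_zero_iff hme.measurable.aemeasurable] at h
    have := hΛ 1
    rw [h] at this
    simp at this
    linarith
  · rw [hme.map_apply]
    simp
  · intro ψ hψ hψ0
    rw [hme.integral_map]
    have := hΛ (R ψ hψ)
    simp only [R, ContinuousMap.coe_mk] at this
    rw [this]
    exact hBpos _ ⟨ψ, hψ, hψ0, fun x => rfl⟩

lemma gauss_test {d μ c s : ℝ} {a : EuclideanSpace ℝ (Fin n) → EuclideanSpace ℝ (Fin n)}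
    (hs : s ≠ 0) (p x : EuclideanSpace ℝ (Fin n)) :
    Lop d μ a (fun y => c * Real.exp (-‖y - p‖^2 / (4 * s))) x =
      (d * (‖x - p‖^2 / (4 * s^2) - n / (2 * s)) + inner ℝ (a x) (x - p) / (2 * s) + μ) *
        (c * Real.exp (-‖x - p‖^2 / (4 * s))) := by
  set G := (fun y : EuclideanSpace ℝ (Fin n) => c * Real.exp (-‖y - p‖^2 / (4 * s))) with hG
  have hfd : ∀ y, HasFDerivAt G ((G y * (-1 / (2 * s))) • innerSL ℝ (y - p)) y := by
    intro y
    have h1 : HasFDerivAt (fun y : EuclideanSpace ℝ (Fin n) => ‖y - p‖^2) (2 • (innerSL ℝ (y - p))) y := by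
      have := ((hasFDerivAt_id y).sub_const p).norm_sq
      exact this
    have h2 := (((h1.neg).mul_const (1 / (4 * s))).exp).const_mul c
    simp only [mul_one_div] at h2
    refine h2.congr_fderiv ?_
    ext v
    simp [hG]
    field_simp
    ring
  have hpd : ∀ i y, pd G i y = G y * (-1 / (2 * s)) * (y i - p i) := by
    intro i y
    unfold pd
    rw [(hfd y).fderiv]
    simp [EuclideanSpace.inner_single_right]
  have hpd2 : ∀ i, pd2 G i i x = G x * ((x i - p i)^2 / (4 * s^2) - 1 / (2 * s)) := by
    intro i
    unfold pd2 
    simp_rw [hpd]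
    unfold pd
    have h3 : HasFDerivAt (fun y : EuclideanSpace ℝ (Fin n) => y i - p i) (EuclideanSpace.proj i : _ →L[ℝ] ℝ) x :=
      ((EuclideanSpace.proj i : EuclideanSpace ℝ (Fin n) →L[ℝ] ℝ).hasFDerivAt).sub_const _
    have h4 := (((hfd x).mul_const (-1 / (2 * s))).mul h3)
    rw [show (fun y => G y * (-1 / (2 * s)) * (y i - p i)) = ((fun y => G y * (-1 / (2 * s))) * fun y => y.ofLp i - p.ofLp i) from rfl, h4.fderiv]
    simp [EuclideanSpace.inner_single_right]
    field_simp
    ring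
  unfold Lop lap
  simp_rw [hpd, hpd2]
  have e1 : ‖x - p‖^2 = ∑ i, (x i - p i)^2 := by
    rw [EuclideanSpace.norm_sq_eq]; simp
  have e2 : inner ℝ (a x) (x - p) = ∑ i, a x i * (x i - p i) := by
    simp [PiLp.inner_apply, mul_comm]
  have e3 : ∑ i, G x * ((x i - p i)^2 / (4 * s^2) - 1 / (2 * s)) = G x * (‖x - p‖^2 / (4 * s^2) - n / (2 * s)) := by
    rw [← Finset.mul_sum, Finset.sum_sub_distrib, e1, Finset.sum_div]
    simp; left; ring
  have e4 : ∑ i, a x i * (G x * (-1 / (2 * s)) * (x i - p i)) = -(G x * inner ℝ (a x) (x - p) / (2 * s)) := by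
    rw [e2, Finset.mul_sum, Finset.sum_div, ← Finset.sum_neg_distrib]
    refine Finset.sum_congr rfl fun i _ => by ring
  rw [e3, e4]
  ring

/-- Heat kernel. -/
def Gk (s : ℝ) (z : EuclideanSpace ℝ (Fin n)) : ℝ :=
  (4 * π * s) ^ (-((n : ℝ) / 2)) * Real.exp (-‖z‖^2 / (4 * s))

lemma Gk_pos {s : ℝ} (hs : 0 < s) (z : EuclideanSpace ℝ (Fin n)) : 0 < Gk s z := by
  unfold Gk; positivity

lemma Gk_cont (s : ℝ) : Continuous (Gk s : EuclideanSpace ℝ (Fin n) → ℝ) := by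
  unfold Gk; fun_prop

lemma Gk_neg (s : ℝ) (z : EuclideanSpace ℝ (Fin n)) : Gk s (-z) = Gk s z := by
  unfold Gk; rw [norm_neg]

lemma gauss_integrable {b : ℝ} (hb : 0 < b) :
    Integrable (fun v : EuclideanSpace ℝ (Fin n) => Real.exp (-b * ‖v‖^2)) := by
  have := (GaussianFourier.integrable_cexp_neg_mul_sq_norm_add (V := EuclideanSpace ℝ (Fin n))
    (b := (b : ℂ)) (by simpa using hb) 0 0).norm
  refine this.congr (ae_of_all _ fun v => ?_)
  simp only [Complex.norm_exp]
  congr 1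
  simp [← Complex.ofReal_pow]

lemma gauss_fourier {b : ℝ} (hb : 0 < b) (z : EuclideanSpace ℝ (Fin n)) :
    ∫ v : EuclideanSpace ℝ (Fin n), Real.exp (-b * ‖v‖^2) * Real.cos (inner ℝ z v) =
      (π / b) ^ ((n : ℝ) / 2) * Real.exp (-‖z‖^2 / (4 * b)) := by
  have h := GaussianFourier.integral_cexp_neg_mul_sq_norm_add (V := EuclideanSpace ℝ (Fin n))
    (b := (b : ℂ)) (by simpa using hb) Complex.I z
  have hi := (GaussianFourier.integrable_cexp_neg_mul_sq_norm_add (V := EuclideanSpace ℝ (Fin n))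
    (b := (b : ℂ)) (by simpa using hb) Complex.I z)
  have h2 := congrArg Complex.re h
  rw [← RCLike.re_eq_complex_re, ← integral_re hi] at h2
  have e1 : ∀ v : EuclideanSpace ℝ (Fin n), RCLike.re (Complex.exp (-(b:ℂ) * (‖v‖:ℂ)^2 + Complex.I * ((inner ℝ z v : ℝ) : ℂ))) =
      Real.exp (-b * ‖v‖^2) * Real.cos (inner ℝ z v) := by
    intro v
    rw [RCLike.re_eq_complex_re, Complex.exp_re]
    congr 2 <;> simp [← Complex.ofReal_pow]
  simp_rw [e1] at h2
  rw [h2]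
  have e2 : ((π:ℂ) / b) ^ ((Module.finrank ℝ (EuclideanSpace ℝ (Fin n)) : ℂ) / 2) = (((π / b) ^ ((n : ℝ) / 2) : ℝ) : ℂ) := by
    rw [Complex.ofReal_cpow (by positivity)]
    simp
  have e3 : Complex.exp (Complex.I ^ 2 * (‖z‖:ℂ)^2 / (4 * b)) = ((Real.exp (-‖z‖^2 / (4 * b)) : ℝ) : ℂ) := by
    push_cast; simp
  rw [e2, e3, ← Complex.ofReal_mul]
  exact Complex.ofReal_re _

lemma Gk_const {s : ℝ} (hs : 0 < s) : (2 * π)^n * (4 * π * s) ^ (-((n : ℝ) / 2)) = (π / s) ^ ((n : ℝ) / 2) := by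
  have h1 : (2 * π)^n = (4 * π^2) ^ ((n : ℝ) / 2) := by
    rw [show 4 * π^2 = (2 * π)^(2:ℝ) by norm_num; ring, ← Real.rpow_mul (by positivity), ← Real.rpow_natCast]
    congr 1; ring
  rw [h1, Real.rpow_neg (by positivity), ← div_eq_mul_inv, ← Real.div_rpow (by positivity) (by positivity)]
  congr 1; field_simp

lemma Gk_fourier {s : ℝ} (hs : 0 < s) (z : EuclideanSpace ℝ (Fin n)) :
    ∫ v : EuclideanSpace ℝ (Fin n), Real.exp (-s * ‖v‖^2) * Real.cos (inner ℝ z v) =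
      (2 * π)^n * Gk s z := by
  rw [gauss_fourier hs, Gk, ← mul_assoc, Gk_const hs]

lemma Gk_integrable {s : ℝ} (hs : 0 < s) : Integrable (Gk s : EuclideanSpace ℝ (Fin n) → ℝ) := by
  have := (gauss_integrable (n := n) (b := 1 / (4 * s)) (by positivity)).const_mul ((4 * π * s) ^ (-((n : ℝ) / 2)))
  refine this.congr (ae_of_all _ fun v => ?_)
  simp only [Gk]; congr 2; field_simp

lemma Gk_integral {s : ℝ} (hs : 0 < s) : ∫ z : EuclideanSpace ℝ (Fin n), Gk s z = 1 := by
  have := GaussianFourier.integral_rexp_neg_mul_sq_norm (V := EuclideanSpace ℝ (Fin n)) (b := 1 / (4 * s)) (by positivity)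
  unfold Gk
  rw [integral_const_mul]
  have e : ∀ v : EuclideanSpace ℝ (Fin n), Real.exp (-‖v‖^2 / (4 * s)) = Real.exp (-(1 / (4 * s)) * ‖v‖^2) := by
    intro v; congr 1; field_simp
  simp_rw [e]
  rw [this, Real.rpow_neg (by positivity)]
  simp only [finrank_euclideanSpace, Fintype.card_fin]
  rw [show π / (1 / (4 * s)) = 4 * π * s by field_simp]
  exact inv_mul_cancel₀ (by positivity)

lemma Gk_semigroup {s : ℝ} (hs : 0 < s) (y y' : EuclideanSpace ℝ (Fin n)) :
    Integrable (fun x : EuclideanSpace ℝ (Fin n) => Gk s (x - y) * Gk s (x - y')) ∧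
    ∫ x : EuclideanSpace ℝ (Fin n), Gk s (x - y) * Gk s (x - y') = Gk (2 * s) (y - y') := by
  set m := (1/2 : ℝ) • (y + y') with hm
  have e : ∀ x, Gk s (x - y) * Gk s (x - y') = Gk (s / 2) (x - m) * Gk (2 * s) (y - y') := by
    intro x
    have hpar := parallelogram_law_with_norm ℝ (x - y) (x - y')
    have h1 : x - y + (x - y') = (2:ℝ) • (x - m) := by
      rw [hm, smul_sub, smul_smul]; norm_num; rw [two_smul]; abel
    have h2 : x - y - (x - y') = -(y - y') := by abel
    rw [h1, h2, norm_neg, norm_smul] at hpar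
    norm_num at hpar
    unfold Gk
    rw [mul_mul_mul_comm, mul_mul_mul_comm _ (Real.exp _), ← Real.exp_add, ← Real.exp_add,
      ← Real.mul_rpow (by positivity) (by positivity), ← Real.mul_rpow (by positivity) (by positivity)]
    congr 2
    · field_simp
    · field_simp
      nlinarith
  simp_rw [e]
  constructor
  · exact ((Gk_integrable (by positivity)).comp_sub_right m).mul_const _
  · rw [integral_mul_const, integral_sub_right_eq_self (fun x => Gk (s/2) x), Gk_integral (by positivity), one_mul]

lemma Gk_bound {s : ℝ} (hs : 0 < s) (z : EuclideanSpace ℝ (Fin n)) :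
    ‖z‖^2 / (4 * s) * Gk s z ≤ 2 ^ ((n:ℝ)/2) * Gk (2 * s) z := by
  unfold Gk
  have h1 : (4 * π * (2 * s)) ^ (-((n : ℝ) / 2)) = 2 ^ (-((n : ℝ) / 2)) * (4 * π * s) ^ (-((n : ℝ) / 2)) := by
    rw [← Real.mul_rpow (by positivity) (by positivity)]; congr 1; ring
  have h2 : (2:ℝ) ^ ((n:ℝ)/2) * 2 ^ (-((n : ℝ) / 2)) = 1 := by
    rw [← Real.rpow_add (by positivity)]; simp
  rw [h1]
  set t := ‖z‖^2 / (4 * s) with ht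
  have h3 : t * Real.exp (-‖z‖^2 / (4 * s)) ≤ Real.exp (-‖z‖^2 / (4 * (2 * s))) := by
    have e1 : -‖z‖^2 / (4 * s) = -t := by rw [ht]; ring
    have e2 : -‖z‖^2 / (4 * (2 * s)) = -t + t / 2 := by rw [ht]; field_simp; ring
    rw [e1, e2, Real.exp_add, mul_comm]
    gcongr
    have := Real.add_one_le_exp (t / 2 - 1)
    have h5 : Real.exp (t/2 - 1) * 2 ≤ Real.exp (t/2) := by
      have : Real.exp (t/2) = Real.exp (t/2 - 1) * Real.exp 1 := by rw [← Real.exp_add]; congr 1; ring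
      rw [this]; gcongr
      linarith [Real.add_one_le_exp (1:ℝ)]
    linarith
  calc t * ((4 * π * s) ^ (-((n : ℝ) / 2)) * Real.exp (-‖z‖^2 / (4 * s)))
      = (4 * π * s) ^ (-((n : ℝ) / 2)) * (t * Real.exp (-‖z‖^2 / (4 * s))) := by ring
    _ ≤ (4 * π * s) ^ (-((n : ℝ) / 2)) * Real.exp (-‖z‖^2 / (4 * (2 * s))) := by gcongr
    _ = (2 ^ ((n:ℝ)/2) * 2 ^ (-((n : ℝ) / 2))) * ((4 * π * s) ^ (-((n : ℝ) / 2)) * Real.exp (-‖z‖^2 / (4 * (2 * s)))) := by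
      rw [h2, one_mul]
    _ = _ := by ring

lemma sq_exp_le {s : ℝ} (hs : 0 < s) (t : ℝ) : t * Real.exp (-s * t) ≤ (2 / s) * Real.exp (-(s/2) * t) := by
  have h := Real.add_one_le_exp (s/2 * t)
  have e : Real.exp (-(s/2) * t) = Real.exp (-s * t) * Real.exp (s/2*t) := by
    rw [← Real.exp_add]; congr 1; ring
  rw [e]
  have : t ≤ 2 / s * Real.exp (s/2*t) := by
    calc t = 2 / s * (s/2 * t) := by field_simp
      _ ≤ _ := by gcongr; linarith
  calc _ ≤ (2 / s * Real.exp (s/2*t)) * Real.exp (-s * t) := by gcongr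
    _ = _ := by ring

lemma gauss2_integrable {s : ℝ} (hs : 0 < s) :
    Integrable (fun v : EuclideanSpace ℝ (Fin n) => ‖v‖^2 * Real.exp (-s * ‖v‖^2)) := by
  refine ((gauss_integrable (n := n) (b := s/2) (by positivity)).const_mul (2/s)).mono'
    (by fun_prop) (ae_of_all _ fun v => ?_)
  rw [Real.norm_of_nonneg (by positivity)]
  exact sq_exp_le hs _

lemma Gk_fourier2 {s : ℝ} (hs : 0 < s) (z : EuclideanSpace ℝ (Fin n)) :
    ∫ v : EuclideanSpace ℝ (Fin n), ‖v‖^2 * Real.exp (-s * ‖v‖^2) * Real.cos (inner ℝ z v) =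
      -((2 * π)^n * ((‖z‖^2 / (4 * s^2) - n / (2 * s)) * Gk s z)) := by
  have key := (hasDerivAt_integral_of_dominated_loc_of_deriv_le (μ := (volume : Measure (EuclideanSpace ℝ (Fin n))))
    (F := fun t v => Real.exp (-t * ‖v‖^2) * Real.cos (inner ℝ z v))
    (F' := fun t v => -(‖v‖^2 * Real.exp (-t * ‖v‖^2) * Real.cos (inner ℝ z v)))
    (bound := fun v => ‖v‖^2 * Real.exp (-(s/2) * ‖v‖^2)) (x₀ := s) (s := Set.Ioi (s/2))
    (Ioi_mem_nhds (by linarith)) (Eventually.of_forall fun t => by fun_prop)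
    ((gauss_integrable hs).mul_bdd (c := 1) (by fun_prop) (ae_of_all _ fun v => Real.abs_cos_le_one _)) (by fun_prop)
    (ae_of_all _ fun v t ht => by
      rw [norm_neg, norm_mul, norm_mul, Real.norm_of_nonneg (by positivity : 0 ≤ ‖v‖^2), Real.norm_of_nonneg (Real.exp_pos _).le]
      calc _ ≤ ‖v‖^2 * Real.exp (-t * ‖v‖^2) * 1 := by gcongr; exact Real.abs_cos_le_one _
        _ ≤ _ := by
          rw [mul_one]; gcongr; exact (Set.mem_Ioi.1 ht).le)
    (gauss2_integrable (by positivity))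
    (ae_of_all _ fun v t ht => by
      have h1 : HasDerivAt (fun t : ℝ => -t * ‖v‖^2) (-1 * ‖v‖^2) t := ((hasDerivAt_id t).neg).mul_const _
      have := (h1.exp).mul_const (Real.cos (inner ℝ z v))
      refine this.congr_deriv ?_
      ring)).2
  have key2 : HasDerivAt (fun t => (2 * π)^n * Gk t z) ((2 * π)^n * ((‖z‖^2 / (4 * s^2) - n / (2 * s)) * Gk s z)) s := by
    apply HasDerivAt.const_mul
    unfold Gk
    have h1 : HasDerivAt (fun t : ℝ => 4 * π * t) (4 * π) s := by
      simpa using (hasDerivAt_id s).const_mul (4 * π)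
    have h2 := h1.rpow_const (p := -((n : ℝ) / 2)) (Or.inl (by positivity))
    have h3 : HasDerivAt (fun t : ℝ => -‖z‖^2 / (4 * t)) (‖z‖^2 / (4 * s^2)) s := by
      have := (hasDerivAt_inv hs.ne').const_mul (-‖z‖^2 / 4)
      refine (this.congr_deriv ?_).congr_of_eventuallyEq ?_
      · field_simp
      · filter_upwards [lt_mem_nhds hs] with t ht
        field_simp
    refine (h2.mul h3.exp).congr_deriv ?_
    rw [Real.rpow_sub_one (by positivity)]
    field_simp
    ring
  have heq : (fun t => ∫ v : EuclideanSpace ℝ (Fin n), Real.exp (-t * ‖v‖^2) * Real.cos (inner ℝ z v)) =ᶠ[𝓝 s]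
      (fun t => (2 * π)^n * Gk t z) := by
    filter_upwards [lt_mem_nhds hs] with t ht using Gk_fourier ht z
  have := key.unique (key2.congr_of_eventuallyEq heq)
  rw [integral_neg] at this
  linarith

/-- Squared modulus of the characteristic function. -/
def Fe (ν : Measure (EuclideanSpace ℝ (Fin n))) (ξ : EuclideanSpace ℝ (Fin n)) : ℝ :=
  ∫ p, Real.cos (inner ℝ (p.1 - p.2) ξ) ∂(ν.prod ν)

/-- Gaussian regularised L2 energy. -/
def Ph (ν : Measure (EuclideanSpace ℝ (Fin n))) (s : ℝ) : ℝ :=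
  ∫ ξ, Real.exp (-s * ‖ξ‖^2) * Fe ν ξ

/-- Gaussian regularised Dirichlet energy. -/
def Ps (ν : Measure (EuclideanSpace ℝ (Fin n))) (s : ℝ) : ℝ :=
  ∫ ξ, (‖ξ‖^2 * Real.exp (-s * ‖ξ‖^2)) * Fe ν ξ

section Fe
variable (ν : Measure (EuclideanSpace ℝ (Fin n))) [IsFiniteMeasure ν]

lemma bdd_int {α : Type*} [MeasurableSpace α] {m : Measure α} [IsFiniteMeasure m] {f : α → ℝ}
    (hf : AEStronglyMeasurable f m) (C : ℝ) (hb : ∀ x, |f x| ≤ C) : Integrable f m :=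
  Integrable.of_bound hf C (ae_of_all _ hb)

lemma Fe_nonneg (ξ : EuclideanSpace ℝ (Fin n)) : 0 ≤ Fe ν ξ := by
  unfold Fe
  have e : ∀ p : EuclideanSpace ℝ (Fin n) × EuclideanSpace ℝ (Fin n), Real.cos (inner ℝ (p.1 - p.2) ξ) =
      Real.cos (inner ℝ p.1 ξ) * Real.cos (inner ℝ p.2 ξ) + Real.sin (inner ℝ p.1 ξ) * Real.sin (inner ℝ p.2 ξ) := by
    intro p; rw [inner_sub_left, Real.cos_sub]
  simp_rw [e]
  rw [integral_add, integral_prod_mul (fun x => Real.cos (inner ℝ x ξ)) (fun x => Real.cos (inner ℝ x ξ)),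
    integral_prod_mul (fun x => Real.sin (inner ℝ x ξ)) (fun x => Real.sin (inner ℝ x ξ))]
  · nlinarith [sq_nonneg (∫ x, Real.cos (inner ℝ x ξ) ∂ν), sq_nonneg (∫ x, Real.sin (inner ℝ x ξ) ∂ν)]
  · apply bdd_int (by fun_prop) 1
    intro p
    rw [abs_mul]
    exact mul_le_one₀ (Real.abs_cos_le_one _) (abs_nonneg _) (Real.abs_cos_le_one _)
  · apply bdd_int (by fun_prop) 1
    intro p
    rw [abs_mul]
    exact mul_le_one₀ (Real.abs_sin_le_one _) (abs_nonneg _) (Real.abs_sin_le_one _)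

lemma Fe_le (ξ : EuclideanSpace ℝ (Fin n)) : Fe ν ξ ≤ (ν.real Set.univ)^2 := by
  unfold Fe
  calc _ ≤ ∫ p, (1:ℝ) ∂(ν.prod ν) := by
        apply integral_mono (bdd_int (by fun_prop) 1 (fun p => Real.abs_cos_le_one _)) (integrable_const _)
        intro p; exact Real.cos_le_one _
    _ = _ := by
      simp [measureReal_def, ← Set.univ_prod_univ, sq]

lemma Fe_cont : Continuous (Fe ν) := by
  unfold Fe
  apply continuous_of_dominated (bound := fun _ => 1)
  · intro ξ; fun_prop
  · intro ξ; exact ae_of_all _ fun p => Real.abs_cos_le_one _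
  · exact integrable_const _
  · exact ae_of_all _ fun p => by fun_prop

lemma Fe_fub {w : EuclideanSpace ℝ (Fin n) → ℝ} (hw : Integrable w) :
    ∫ p, (∫ ξ, w ξ * Real.cos (inner ℝ (p.1 - p.2) ξ)) ∂(ν.prod ν) = ∫ ξ, w ξ * Fe ν ξ := by
  rw [integral_integral_swap]
  · simp_rw [integral_const_mul]; rfl
  · have h1 : Integrable (fun q : (EuclideanSpace ℝ (Fin n) × EuclideanSpace ℝ (Fin n)) × EuclideanSpace ℝ (Fin n) => w q.2)
        ((ν.prod ν).prod volume) := hw.comp_snd _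
    exact h1.mul_bdd (c := 1) (by fun_prop) (ae_of_all _ fun q => Real.abs_cos_le_one _)

lemma mul_Fe_integrable {w : EuclideanSpace ℝ (Fin n) → ℝ} (hw : Integrable w) :
    Integrable (fun ξ => w ξ * Fe ν ξ) :=
  hw.mul_bdd (c := (ν.real Set.univ)^2) (Fe_cont ν).aestronglyMeasurable (ae_of_all _ fun ξ => by
    rw [Real.norm_of_nonneg (Fe_nonneg ν ξ)]; exact Fe_le ν ξ)

lemma Q_eq {s : ℝ} (hs : 0 < s) : (2 * π)^n * ∫ p, Gk s (p.1 - p.2) ∂(ν.prod ν) = Ph ν s := by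
  unfold Ph
  rw [← Fe_fub ν (gauss_integrable hs), ← integral_const_mul]
  congr 1; ext p
  rw [Gk_fourier hs]

lemma D_eq {s : ℝ} (hs : 0 < s) : (2 * π)^n * ∫ p, ((‖p.1 - p.2‖^2 / (4 * s^2) - n / (2 * s)) * Gk s (p.1 - p.2)) ∂(ν.prod ν)
    = - Ps ν s := by
  unfold Ps
  rw [← Fe_fub ν (gauss2_integrable hs), ← integral_const_mul, ← integral_neg]
  congr 1; ext p
  rw [Gk_fourier2 hs, neg_neg]

lemma Ph_nonneg (s : ℝ) : 0 ≤ Ph ν s :=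
  integral_nonneg fun ξ => mul_nonneg (Real.exp_pos _).le (Fe_nonneg ν ξ)

lemma Ph_anti {s t : ℝ} (hs : 0 < s) (hst : s ≤ t) : Ph ν t ≤ Ph ν s := by
  apply integral_mono (mul_Fe_integrable ν (gauss_integrable (hs.trans_le hst))) (mul_Fe_integrable ν (gauss_integrable hs))
  intro ξ
  apply mul_le_mul_of_nonneg_right _ (Fe_nonneg ν ξ)
  apply Real.exp_le_exp.2
  nlinarith [sq_nonneg ‖ξ‖]

lemma cont_int {K : Set (EuclideanSpace ℝ (Fin n))} (hK : IsCompact K) (hν : ν Kᶜ = 0)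
    {f : EuclideanSpace ℝ (Fin n) × EuclideanSpace ℝ (Fin n) → ℝ} (hf : Continuous f) :
    Integrable f (ν.prod ν) := by
  have h1 : ν.restrict K = ν := Measure.restrict_eq_self_of_ae_mem (by
    rw [ae_iff]; exact hν)
  have h2 : (ν.prod ν).restrict (K ×ˢ K) = ν.prod ν := by
    rw [← Measure.prod_restrict, h1]
  rw [← h2]
  exact hf.continuousOn.integrableOn_compact (hK.prod hK)

end Fe

/-- Symmetrised drift kernel. -/
def kern (a : EuclideanSpace ℝ (Fin n) → EuclideanSpace ℝ (Fin n)) (s : ℝ)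
    (p : EuclideanSpace ℝ (Fin n) × EuclideanSpace ℝ (Fin n)) : ℝ :=
  inner ℝ (a p.1 - a p.2) (p.1 - p.2) / (4 * s) * Gk s (p.1 - p.2)

lemma kern_cont {a : EuclideanSpace ℝ (Fin n) → EuclideanSpace ℝ (Fin n)} (ha : Continuous a) (s : ℝ) :
    Continuous (kern a s) := by
  unfold kern
  have := Gk_cont (n := n) s
  fun_prop

lemma kern_bound {a : EuclideanSpace ℝ (Fin n) → EuclideanSpace ℝ (Fin n)} {L : NNReal}
    (ha : LipschitzWith L a) {s : ℝ} (hs : 0 < s) (p : EuclideanSpace ℝ (Fin n) × EuclideanSpace ℝ (Fin n)) :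
    |kern a s p| ≤ L * 2 ^ ((n:ℝ)/2) * Gk (2 * s) (p.1 - p.2) := by
  unfold kern
  have h1 : |inner ℝ (a p.1 - a p.2) (p.1 - p.2)| ≤ L * ‖p.1 - p.2‖^2 := by
    calc _ ≤ ‖a p.1 - a p.2‖ * ‖p.1 - p.2‖ := abs_real_inner_le_norm _ _
      _ ≤ (L * ‖p.1 - p.2‖) * ‖p.1 - p.2‖ := by
        gcongr; exact ha.norm_sub_le _ _
      _ = _ := by ring
  rw [abs_mul, abs_div, abs_of_pos (Gk_pos hs _), abs_of_pos (by positivity : 0 < 4 * s)]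
  have h2 := Gk_pos hs (p.1 - p.2)
  calc _ ≤ L * ‖p.1 - p.2‖^2 / (4 * s) * Gk s (p.1 - p.2) := by gcongr
    _ = L * (‖p.1 - p.2‖^2 / (4 * s) * Gk s (p.1 - p.2)) := by ring
    _ ≤ L * (2 ^ ((n:ℝ)/2) * Gk (2 * s) (p.1 - p.2)) := mul_le_mul_of_nonneg_left (Gk_bound hs _) L.coe_nonneg
    _ = _ := by ring

section main
variable {ν : Measure (EuclideanSpace ℝ (Fin n))} [IsFiniteMeasure ν]

lemma main_ineq {d μ : ℝ} {a : EuclideanSpace ℝ (Fin n) → EuclideanSpace ℝ (Fin n)} (ha : Continuous a)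
    {K : Set (EuclideanSpace ℝ (Fin n))} (hK : IsCompact K) (hν : ν Kᶜ = 0)
    (htest : ∀ ψ : EuclideanSpace ℝ (Fin n) → ℝ, ContDiff ℝ 2 ψ → (∀ x, 0 ≤ ψ x) →
        0 ≤ ∫ x, Lop d μ a ψ x ∂ν) {s : ℝ} (hs : 0 < s) :
    d * Ps ν s ≤ μ * Ph ν s + (2 * π)^n * ∫ p, kern a s p ∂(ν.prod ν) := by
  have hG := Gk_cont (n := n) s
  set f1 : EuclideanSpace ℝ (Fin n) × EuclideanSpace ℝ (Fin n) → ℝ := fun p =>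
    (‖p.1 - p.2‖^2 / (4 * s^2) - n / (2 * s)) * Gk s (p.1 - p.2) with hf1
  set f2 : EuclideanSpace ℝ (Fin n) × EuclideanSpace ℝ (Fin n) → ℝ := fun p =>
    inner ℝ (a p.1) (p.1 - p.2) / (2 * s) * Gk s (p.1 - p.2) with hf2
  set f3 : EuclideanSpace ℝ (Fin n) × EuclideanSpace ℝ (Fin n) → ℝ := fun p =>
    Gk s (p.1 - p.2) with hf3
  have i1 : Integrable f1 (ν.prod ν) := cont_int ν hK hν (by fun_prop)
  have i2 : Integrable f2 (ν.prod ν) := cont_int ν hK hν (by fun_prop)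
  have i3 : Integrable f3 (ν.prod ν) := cont_int ν hK hν (by fun_prop)
  have i12 : Integrable (fun p => d * f1 p + f2 p) (ν.prod ν) := (i1.const_mul d).add i2
  have i123 : Integrable (fun p => d * f1 p + f2 p + μ * f3 p) (ν.prod ν) := i12.add (i3.const_mul μ)
  have hpos : 0 ≤ ∫ p, (d * f1 p + f2 p + μ * f3 p) ∂(ν.prod ν) := by
    rw [integral_prod_symm _ i123]
    apply integral_nonneg
    intro y'
    have := htest (fun y => (4 * π * s) ^ (-((n : ℝ) / 2)) * Real.exp (-‖y - y'‖^2 / (4 * s)))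
      (by
        apply contDiff_const.mul
        apply ContDiff.exp
        exact ((((contDiff_id.sub contDiff_const).norm_sq ℝ).neg).div_const _))
      (fun x => by positivity)
    simp_rw [gauss_test hs.ne'] at this
    refine this.trans_eq (integral_congr_ae (ae_of_all _ fun y => ?_))
    simp only [hf1, hf2, hf3, Gk]; ring
  rw [integral_add i12 (i3.const_mul μ), integral_add (i1.const_mul d) i2,
    integral_const_mul, integral_const_mul] at hpos
  have hsym : ∫ p, f2 p ∂(ν.prod ν) = ∫ p, kern a s p ∂(ν.prod ν) := by
    have h1 : ∫ p, f2 p ∂(ν.prod ν) = ∫ p, f2 p.swap ∂(ν.prod ν) :=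
      (integral_prod_swap f2).symm
    have i2' : Integrable (fun p => f2 p.swap) (ν.prod ν) := i2.swap
    have h2 : ∫ p, kern a s p ∂(ν.prod ν) = ∫ p, (1/2 * f2 p + 1/2 * f2 p.swap) ∂(ν.prod ν) := by
      congr 1; ext p
      simp only [kern, hf2, Prod.fst_swap, Prod.snd_swap]
      rw [← neg_sub p.1 p.2, Gk_neg, inner_neg_right, inner_sub_left]
      field_simp; ring
    rw [h2, integral_add (i2.const_mul _) (i2'.const_mul _), integral_const_mul, integral_const_mul, ← h1]
    ring
  rw [hsym] at hpos
  have e1 := D_eq ν hs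
  have e3 := Q_eq ν hs
  have : 0 ≤ (2 * π)^n * (d * ∫ p, f1 p ∂(ν.prod ν) + ∫ p, kern a s p ∂(ν.prod ν) + μ * ∫ p, f3 p ∂(ν.prod ν)) := by
    have := pi_pos
    positivity
  have e4 : (2 * π)^n * (d * ∫ p, f1 p ∂(ν.prod ν) + ∫ p, kern a s p ∂(ν.prod ν) + μ * ∫ p, f3 p ∂(ν.prod ν)) =
     d * ((2 * π)^n * ∫ p, f1 p ∂(ν.prod ν)) + (2 * π)^n * ∫ p, kern a s p ∂(ν.prod ν) + μ * ((2 * π)^n * ∫ p, f3 p ∂(ν.prod ν)) := by ring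
  rw [e4, e1, e3] at this
  linarith

lemma J_le {a : EuclideanSpace ℝ (Fin n) → EuclideanSpace ℝ (Fin n)} {L : NNReal} (ha : LipschitzWith L a)
    {K : Set (EuclideanSpace ℝ (Fin n))} (hK : IsCompact K) (hν : ν Kᶜ = 0) {s : ℝ} (hs : 0 < s) :
    (2 * π)^n * ∫ p, kern a s p ∂(ν.prod ν) ≤ (L * 2 ^ ((n:ℝ)/2)) * Ph ν (2 * s) := by
  rw [← Q_eq ν (by positivity : 0 < 2 * s), mul_left_comm, ← integral_const_mul (L * 2 ^ ((n:ℝ)/2) : ℝ)]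
  have hG := Gk_cont (n := n) (2 * s)
  have := pi_pos
  gcongr
  · exact cont_int ν hK hν (kern_cont ha.continuous s)
  · exact cont_int ν hK hν (by fun_prop)
  · intro p
    exact (le_abs_self _).trans (kern_bound ha hs p)

lemma Ph_bdd {d μ : ℝ} (hd : 0 < d) (hμ : 0 < μ) {a : EuclideanSpace ℝ (Fin n) → EuclideanSpace ℝ (Fin n)}
    {L : NNReal} (ha : LipschitzWith L a)
    {K : Set (EuclideanSpace ℝ (Fin n))} (hK : IsCompact K) (hν : ν Kᶜ = 0)
    (htest : ∀ ψ : EuclideanSpace ℝ (Fin n) → ℝ, ContDiff ℝ 2 ψ → (∀ x, 0 ≤ ψ x) →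
        0 ≤ ∫ x, Lop d μ a ψ x ∂ν) : ∃ M, ∀ s, 0 < s → Ph ν s ≤ M := by
  set C : ℝ := L * 2 ^ ((n:ℝ)/2) with hC
  have hC0 : 0 ≤ C := by positivity
  set R := Real.sqrt (2 * (μ + C) / d) with hR
  have hR2 : R^2 = 2 * (μ + C) / d := Real.sq_sqrt (by positivity)
  have hRpos : 0 < R^2 := by rw [hR2]; positivity
  set c := (ν.real Set.univ)^2 with hc
  set V := volume.real (Metric.ball (0 : EuclideanSpace ℝ (Fin n)) R) with hV
  refine ⟨2 * (c * V), fun s hs => ?_⟩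
  have h1 : d * Ps ν s ≤ (μ + C) * Ph ν s := by
    have h1 := main_ineq ha.continuous hK hν htest hs
    have h2 := J_le (ν := ν) ha hK hν hs
    have h3 := mul_le_mul_of_nonneg_left (Ph_anti ν hs (by linarith : s ≤ 2 * s)) hC0
    linarith
  have h2 : Ph ν s ≤ c * V + (R^2)⁻¹ * Ps ν s := by
    have ib : Integrable (Set.indicator (Metric.ball (0 : EuclideanSpace ℝ (Fin n)) R) (fun _ => c)) :=
      (integrable_indicator_iff measurableSet_ball).2 (by simp [measure_ball_lt_top])
    have ip := mul_Fe_integrable ν (gauss2_integrable hs)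
    calc Ph ν s ≤ ∫ ξ, (Set.indicator (Metric.ball (0 : EuclideanSpace ℝ (Fin n)) R) (fun _ => c) ξ +
          (R^2)⁻¹ * ((‖ξ‖^2 * Real.exp (-s * ‖ξ‖^2)) * Fe ν ξ)) := by
            apply integral_mono (mul_Fe_integrable ν (gauss_integrable hs)) (ib.add (ip.const_mul _))
            intro ξ
            have hF := Fe_nonneg ν ξ
            have hF2 := Fe_le ν ξ
            simp only [Pi.add_apply]
            by_cases hξ : ξ ∈ Metric.ball (0 : EuclideanSpace ℝ (Fin n)) R
            · rw [Set.indicator_of_mem hξ]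
              have : Real.exp (-s * ‖ξ‖^2) ≤ 1 := Real.exp_le_one_iff.2 (by nlinarith [sq_nonneg ‖ξ‖])
              have h3 : Real.exp (-s * ‖ξ‖^2) * Fe ν ξ ≤ c := by nlinarith
              have : 0 ≤ (R^2)⁻¹ * (‖ξ‖^2 * Real.exp (-s * ‖ξ‖^2) * Fe ν ξ) := by positivity
              linarith
            · rw [Set.indicator_of_notMem hξ, zero_add]
              have hR' : R ≤ ‖ξ‖ := by simpa using hξ
              have : 1 ≤ (R^2)⁻¹ * ‖ξ‖^2 := by
                rw [inv_mul_eq_div, one_le_div hRpos]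
                gcongr
              calc Real.exp (-s * ‖ξ‖^2) * Fe ν ξ = 1 * (Real.exp (-s * ‖ξ‖^2) * Fe ν ξ) := by ring
                _ ≤ ((R^2)⁻¹ * ‖ξ‖^2) * (Real.exp (-s * ‖ξ‖^2) * Fe ν ξ) := by gcongr
                _ = _ := by ring
      _ = _ := by
        rw [integral_add ib (ip.const_mul _), integral_const_mul, integral_indicator measurableSet_ball]
        simp [Ps, hV, mul_comm]
  have h3 : (R^2)⁻¹ * Ps ν s ≤ Ph ν s / 2 := by
    rw [hR2, inv_div]
    have : d / (2 * (μ + C)) * Ps ν s = (d * Ps ν s) / (2 * (μ + C)) := by ring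
    rw [this, div_le_iff₀ (by positivity)]
    linarith
  linarith

lemma Fe_integrable {M : ℝ} (hM : ∀ s, 0 < s → Ph ν s ≤ M) : Integrable (Fe ν) := by
  have hmeas := (Fe_cont ν).aestronglyMeasurable (μ := volume)
  refine ⟨hmeas, ?_⟩
  have hlim : ∀ ξ, Tendsto (fun k : ℕ => ENNReal.ofReal (Real.exp (-(1 / ((k:ℝ) + 1)) * ‖ξ‖^2) * Fe ν ξ)) atTop
      (𝓝 (ENNReal.ofReal (Fe ν ξ))) := by
    intro ξ
    apply ENNReal.tendsto_ofReal
    have h := tendsto_one_div_add_atTop_nhds_zero_nat (𝕜 := ℝ)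
    have := (((h.neg.mul_const (‖ξ‖^2)).rexp).mul_const (Fe ν ξ))
    simpa using this
  have : ∫⁻ ξ, ENNReal.ofReal (Fe ν ξ) ≤ ENNReal.ofReal M := by
    calc _ = ∫⁻ ξ, liminf (fun k : ℕ => ENNReal.ofReal (Real.exp (-(1 / ((k:ℝ) + 1)) * ‖ξ‖^2) * Fe ν ξ)) atTop := by
          congr 1; ext ξ; exact (hlim ξ).liminf_eq.symm
      _ ≤ liminf (fun k : ℕ => ∫⁻ ξ, ENNReal.ofReal (Real.exp (-(1 / ((k:ℝ) + 1)) * ‖ξ‖^2) * Fe ν ξ)) atTop := by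
          apply lintegral_liminf_le
          intro k
          have := Fe_cont ν
          apply Measurable.ennreal_ofReal
          apply Continuous.measurable; fun_prop
      _ ≤ ENNReal.ofReal M := by
          apply liminf_le_of_le
          · isBoundedDefault
          · intro b hb
            obtain ⟨k, hk⟩ := hb.exists
            refine hk.trans ?_
            rw [← ofReal_integral_eq_lintegral_ofReal (mul_Fe_integrable ν (gauss_integrable (by positivity)))
              (ae_of_all _ fun ξ => mul_nonneg (Real.exp_pos _).le (Fe_nonneg ν ξ))]
            exact ENNReal.ofReal_le_ofReal (hM _ (by positivity))
  rw [hasFiniteIntegral_iff_ofReal (ae_of_all _ (Fe_nonneg ν))]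
  exact this.trans_lt ENNReal.ofReal_lt_top

lemma Ph_tendsto (hF : Integrable (Fe ν)) {σ : ℕ → ℝ} (hσ0 : ∀ k, 0 < σ k) (hσ : Tendsto σ atTop (𝓝 0)) :
    Tendsto (fun k => Ph ν (σ k)) atTop (𝓝 (∫ ξ, Fe ν ξ)) := by
  have hc := Fe_cont ν
  apply tendsto_integral_of_dominated_convergence (Fe ν)
  · intro k; exact (by fun_prop : Continuous _).aestronglyMeasurable
  · exact hF
  · intro k
    refine ae_of_all _ fun ξ => ?_
    have := Fe_nonneg ν ξ
    rw [Real.norm_of_nonneg (by positivity)]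
    have : Real.exp (-σ k * ‖ξ‖^2) ≤ 1 := Real.exp_le_one_iff.2 (by nlinarith [sq_nonneg ‖ξ‖, hσ0 k])
    nlinarith
  · refine ae_of_all _ fun ξ => ?_
    have := (((hσ.neg.mul_const (‖ξ‖^2)).rexp).mul_const (Fe ν ξ))
    simpa using this

lemma Ph_le (hF : Integrable (Fe ν)) {s : ℝ} (hs : 0 < s) : Ph ν s ≤ ∫ ξ, Fe ν ξ := by
  apply integral_mono (mul_Fe_integrable ν (gauss_integrable hs)) hF
  intro ξ
  have := Fe_nonneg ν ξ
  have : Real.exp (-s * ‖ξ‖^2) ≤ 1 := Real.exp_le_one_iff.2 (by nlinarith [sq_nonneg ‖ξ‖])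
  simp only
  nlinarith
end main

lemma Gk_scale {r : ℝ} (hr : 0 < r) (w : EuclideanSpace ℝ (Fin n)) :
    Gk (r^2) (r • w) = (r^n)⁻¹ * Gk 1 w := by
  unfold Gk
  have h1 : (4 * π * r^2) ^ (-((n : ℝ) / 2)) = (r^n)⁻¹ * (4 * π * 1) ^ (-((n : ℝ) / 2)) := by
    rw [mul_one, Real.mul_rpow (by positivity) (by positivity), mul_comm]
    congr 1
    rw [← Real.rpow_natCast r 2, ← Real.rpow_mul hr.le, ← Real.rpow_natCast r n, ← Real.rpow_neg hr.le]
    congr 1; push_cast; ring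
  rw [h1, norm_smul, Real.norm_of_nonneg hr.le, mul_assoc]
  congr 3
  field_simp

/-- Standard Gaussian probability measure. -/
def Gam : Measure (EuclideanSpace ℝ (Fin n)) := volume.withDensity (fun w => ENNReal.ofReal (Gk 1 w))

lemma Gam_univ : (Gam : Measure (EuclideanSpace ℝ (Fin n))) Set.univ = 1 := by
  unfold Gam
  rw [withDensity_apply _ MeasurableSet.univ, Measure.restrict_univ,
    ← ofReal_integral_eq_lintegral_ofReal (Gk_integrable one_pos) (ae_of_all _ fun z => (Gk_pos one_pos z).le),
    Gk_integral one_pos, ENNReal.ofReal_one]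

lemma Gam_scale {r : ℝ} (hr : 0 < r) {h : EuclideanSpace ℝ (Fin n) → ℝ≥0∞} (hh : Measurable h) :
    ∫⁻ w, h (r • w) ∂Gam = ∫⁻ z, h z * ENNReal.ofReal (Gk (r^2) z) := by
  unfold Gam
  have hG := (Gk_cont (n := n) 1).measurable
  have hGr := (Gk_cont (n := n) (r^2)).measurable
  rw [lintegral_withDensity_eq_lintegral_mul _ hG.ennreal_ofReal (show Measurable (fun w => h (r • w)) from hh.comp (measurable_const_smul r))]
  have e : ∀ w : EuclideanSpace ℝ (Fin n), (((fun w : EuclideanSpace ℝ (Fin n) => ENNReal.ofReal (Gk 1 w)) * fun w : EuclideanSpace ℝ (Fin n) => h (r • w)) : EuclideanSpace ℝ (Fin n) → ℝ≥0∞) w =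
      ENNReal.ofReal (r^n) * (fun z => h z * ENNReal.ofReal (Gk (r^2) z)) (r • w) := by
    intro w
    simp only [Pi.mul_apply, Gk_scale hr]
    rw [mul_left_comm, ← ENNReal.ofReal_mul (by positivity), mul_inv_cancel_left₀ (by positivity), mul_comm]
  simp_rw [e]
  have hm : Measurable (fun z => h z * ENNReal.ofReal (Gk (r^2) z)) := hh.mul hGr.ennreal_ofReal
  rw [lintegral_const_mul _ (show Measurable (fun w => (fun z => h z * ENNReal.ofReal (Gk (r^2) z)) (r • w)) from hm.comp (measurable_const_smul r)),
    ← lintegral_map hm (measurable_const_smul r), Measure.map_addHaar_smul _ hr.ne', lintegral_smul_measure,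
    smul_eq_mul, ← mul_assoc, ← ENNReal.ofReal_mul (by positivity)]
  simp only [finrank_euclideanSpace, Fintype.card_fin]
  rw [abs_of_pos (by positivity), mul_inv_cancel₀ (by positivity), ENNReal.ofReal_one, one_mul]

section
variable {ν : Measure (EuclideanSpace ℝ (Fin n))} [IsFiniteMeasure ν]

lemma ns_sq {s : ℝ} (hs : 0 < s) :
    ∫⁻ x, (∫⁻ y, ENNReal.ofReal (Gk s (x - y)) ∂ν)^2 = ∫⁻ p, ENNReal.ofReal (Gk (2 * s) (p.1 - p.2)) ∂(ν.prod ν) := by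
  have hG := (Gk_cont (n := n) s).measurable
  have e : ∀ x, (∫⁻ y, ENNReal.ofReal (Gk s (x - y)) ∂ν)^2 =
      ∫⁻ p, ENNReal.ofReal (Gk s (x - p.1) * Gk s (x - p.2)) ∂(ν.prod ν) := by
    intro x
    have hm : AEMeasurable (fun y => ENNReal.ofReal (Gk s (x - y))) ν := (by fun_prop : Measurable _).aemeasurable
    rw [sq, ← lintegral_prod_mul hm hm]
    congr 1; ext p
    rw [ENNReal.ofReal_mul (Gk_pos hs _).le]
  simp_rw [e]
  rw [lintegral_lintegral_swap]
  · congr 1; ext p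
    obtain ⟨h1, h2⟩ := Gk_semigroup hs p.1 p.2
    rw [← ofReal_integral_eq_lintegral_ofReal h1 (ae_of_all _ fun x => (mul_pos (Gk_pos hs _) (Gk_pos hs _)).le), h2]
  · apply Measurable.aemeasurable
    unfold Function.uncurry
    fun_prop

lemma lemD_lsc {Q : ℝ≥0∞} (hQ : ∀ s, 0 < s → ∫⁻ p, ENNReal.ofReal (Gk s (p.1 - p.2)) ∂(ν.prod ν) ≤ Q)
    {ψ : EuclideanSpace ℝ (Fin n) → ℝ≥0∞} (hψ : LowerSemicontinuous ψ) :
    ∫⁻ y, ψ y ∂ν ≤ (∫⁻ x, (ψ x)^2)^(1/2 : ℝ) * Q^(1/2 : ℝ) := by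
  have hψm := hψ.measurable
  set r : ℕ → ℝ := fun k => 1 / ((k:ℝ) + 1) with hr
  have hr0 : ∀ k, 0 < r k := fun k => by simp only [hr]; positivity
  have hrl : Tendsto r atTop (𝓝 0) := tendsto_one_div_add_atTop_nhds_zero_nat
  have h1 : ∀ y, ψ y ≤ liminf (fun k => ∫⁻ w, ψ (y + r k • w) ∂Gam) atTop := by
    intro y
    calc ψ y = ∫⁻ _w, ψ y ∂(Gam : Measure (EuclideanSpace ℝ (Fin n))) := by rw [lintegral_const, Gam_univ, mul_one]
      _ ≤ ∫⁻ w, liminf (fun k => ψ (y + r k • w)) atTop ∂Gam := by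
        apply lintegral_mono
        intro w
        have ht : Tendsto (fun k => y + r k • w) atTop (𝓝 y) := by
          simpa using (hrl.smul_const w).const_add y
        have h2 : ψ y ≤ liminf ψ (𝓝 y) := lowerSemicontinuousAt_iff_le_liminf.1 (hψ y)
        exact h2.trans (liminf_le_liminf_of_le ht)
      _ ≤ _ := by
        apply lintegral_liminf_le
        intro k
        exact hψm.comp (by fun_prop)
  have h2 : ∀ k, ∫⁻ y, ∫⁻ w, ψ (y + r k • w) ∂Gam ∂ν ≤ (∫⁻ x, (ψ x)^2)^(1/2 : ℝ) * Q^(1/2 : ℝ) := by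
    intro k
    set s := (r k)^2 with hs
    have hs0 : 0 < s := by have := hr0 k; positivity
    have hG := (Gk_cont (n := n) s).measurable
    have e1 : ∀ y, ∫⁻ w, ψ (y + r k • w) ∂Gam = ∫⁻ x, ψ x * ENNReal.ofReal (Gk s (x - y)) := by
      intro y
      rw [Gam_scale (hr0 k) (h := fun z => ψ (y + z)) (hψm.comp (by fun_prop))]
      rw [← lintegral_add_left_eq_self (fun x => ψ x * ENNReal.ofReal (Gk s (x - y))) y]
      simp only [add_sub_cancel_left, hs]
    simp_rw [e1]
    rw [lintegral_lintegral_swap]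
    · have e2 : ∀ x, ∫⁻ y, ψ x * ENNReal.ofReal (Gk s (x - y)) ∂ν = ((ψ * fun x : EuclideanSpace ℝ (Fin n) => ∫⁻ y, ENNReal.ofReal (Gk s (x - y)) ∂ν) : EuclideanSpace ℝ (Fin n) → ℝ≥0∞) x := by
        intro x
        rw [lintegral_const_mul _ (by fun_prop)]; rfl
      simp_rw [e2]
      have hnm : Measurable (fun x => ∫⁻ y, ENNReal.ofReal (Gk s (x - y)) ∂ν) := by
        apply Measurable.lintegral_prod_right' (f := fun p : EuclideanSpace ℝ (Fin n) × EuclideanSpace ℝ (Fin n) => ENNReal.ofReal (Gk s (p.1 - p.2)))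
        fun_prop
      refine (ENNReal.lintegral_mul_le_Lp_mul_Lq volume Real.HolderConjugate.two_two hψm.aemeasurable hnm.aemeasurable).trans ?_
      have e3 := ns_sq (ν := ν) hs0
      simp only [ENNReal.rpow_two]
      rw [e3]
      gcongr
      exact hQ _ (by positivity)
    · apply Measurable.aemeasurable
      unfold Function.uncurry
      exact (hψm.comp measurable_snd).mul (by fun_prop)
  calc ∫⁻ y, ψ y ∂ν ≤ ∫⁻ y, liminf (fun k => ∫⁻ w, ψ (y + r k • w) ∂Gam) atTop ∂ν := lintegral_mono h1
    _ ≤ liminf (fun k => ∫⁻ y, ∫⁻ w, ψ (y + r k • w) ∂Gam ∂ν) atTop := by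
      apply lintegral_liminf_le
      intro k
      have : SFinite (Gam : Measure (EuclideanSpace ℝ (Fin n))) := by
        have : IsFiniteMeasure (Gam : Measure (EuclideanSpace ℝ (Fin n))) := ⟨by rw [Gam_univ]; simp⟩
        infer_instance
      apply Measurable.lintegral_prod_right' (f := fun p : EuclideanSpace ℝ (Fin n) × EuclideanSpace ℝ (Fin n) => ψ (p.1 + r k • p.2))
      exact hψm.comp (by fun_prop)
    _ ≤ _ := by
      apply liminf_le_of_le
      · isBoundedDefault
      · intro b hb
        obtain ⟨k, hk⟩ := hb.exists
        exact hk.trans (h2 k)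

lemma lemD {Q : ℝ≥0∞} (hQt : Q ≠ ⊤) (hQ : ∀ s, 0 < s → ∫⁻ p, ENNReal.ofReal (Gk s (p.1 - p.2)) ∂(ν.prod ν) ≤ Q)
    {ψ : EuclideanSpace ℝ (Fin n) → ℝ≥0∞} (hψ : Measurable ψ) :
    (∫⁻ y, ψ y ∂ν)^2 ≤ Q * ∫⁻ x, (ψ x)^2 := by
  have key : ∀ ε : ℝ≥0∞, ε ≠ 0 → (∫⁻ y, ψ y ∂ν)^2 ≤ Q * ((∫⁻ x, (ψ x)^2) + ε) := by
    intro ε hε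
    obtain ⟨g, hg1, hg2, hg3⟩ := exists_le_lowerSemicontinuous_lintegral_ge volume (fun x => (ψ x)^2) (hψ.pow_const 2) hε
    have hl : LowerSemicontinuous (fun x => (g x)^(1/2 : ℝ)) :=
      ENNReal.continuous_rpow_const.comp_lowerSemicontinuous hg2 (ENNReal.monotone_rpow_of_nonneg (by norm_num))
    have hsq : ∀ t : ℝ≥0∞, (t^(1/2 : ℝ))^2 = t := fun t => by
      rw [← ENNReal.rpow_two, ← ENNReal.rpow_mul]; norm_num
    have h1 := lemD_lsc hQ hl
    simp_rw [hsq] at h1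
    have h2 : ∫⁻ y, ψ y ∂ν ≤ ∫⁻ y, (g y)^(1/2 : ℝ) ∂ν := by
      apply lintegral_mono
      intro y
      calc ψ y = ((ψ y)^2)^(1/2 : ℝ) := by rw [← ENNReal.rpow_two, ← ENNReal.rpow_mul]; norm_num
        _ ≤ _ := ENNReal.rpow_le_rpow (hg1 y) (by norm_num)
    calc _ ≤ ((∫⁻ x, g x)^(1/2 : ℝ) * Q^(1/2 : ℝ))^2 := by gcongr; exact h2.trans h1
      _ = Q * ∫⁻ x, g x := by rw [mul_pow, hsq, hsq, mul_comm]
      _ ≤ _ := by gcongr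
  have ht : Tendsto (fun k : ℕ => Q * ((∫⁻ x, (ψ x)^2) + ((k:ℝ≥0∞))⁻¹)) atTop (𝓝 (Q * ((∫⁻ x, (ψ x)^2) + 0))) := by
    apply ENNReal.Tendsto.const_mul _ (Or.inr hQt)
    exact tendsto_const_nhds.add ENNReal.tendsto_inv_nat_nhds_zero
  rw [add_zero] at ht
  refine ge_of_tendsto' ht fun k => key _ (by simp)

lemma lemD_ac {Q : ℝ≥0∞} (hQt : Q ≠ ⊤) (hQ : ∀ s, 0 < s → ∫⁻ p, ENNReal.ofReal (Gk s (p.1 - p.2)) ∂(ν.prod ν) ≤ Q) :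
    ν ≪ volume := by
  refine Measure.AbsolutelyContinuous.mk fun A hA h0 => ?_
  have := lemD hQt hQ (ψ := A.indicator 1) (measurable_one.indicator hA)
  rw [lintegral_indicator_one hA] at this
  have h2 : ∫⁻ x, (A.indicator 1 x : ℝ≥0∞)^2 = 0 := by
    have : ∀ x, (A.indicator 1 x : ℝ≥0∞)^2 = A.indicator 1 x := fun x => by
      by_cases h : x ∈ A <;> simp [h]
    simp_rw [this]
    rw [lintegral_indicator_one hA, h0]
  rw [h2, mul_zero] at this
  simpa using this

lemma lemD_mass {Q : ℝ≥0∞} (hQt : Q ≠ ⊤) (hQ : ∀ s, 0 < s → ∫⁻ p, ENNReal.ofReal (Gk s (p.1 - p.2)) ∂(ν.prod ν) ≤ Q)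
    {A : Set (EuclideanSpace ℝ (Fin n))} (hA : MeasurableSet A) :
    (ν A)^2 ≤ Q * volume A := by
  have := lemD hQt hQ (ψ := A.indicator 1) (measurable_one.indicator hA)
  rw [lintegral_indicator_one hA] at this
  have h2 : ∫⁻ x, (A.indicator 1 x : ℝ≥0∞)^2 = volume A := by
    have : ∀ x, (A.indicator 1 x : ℝ≥0∞)^2 = A.indicator 1 x := fun x => by
      by_cases h : x ∈ A <;> simp [h]
    simp_rw [this]
    rw [lintegral_indicator_one hA]
  rwa [h2] at this

lemma lemD_L2 {Q : ℝ≥0∞} (hQt : Q ≠ ⊤) (hQ : ∀ s, 0 < s → ∫⁻ p, ENNReal.ofReal (Gk s (p.1 - p.2)) ∂(ν.prod ν) ≤ Q) :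
    ∫⁻ x, (ν.rnDeriv volume x)^2 ≤ Q := by
  have hac := lemD_ac hQt hQ
  set ρ := ν.rnDeriv volume with hρ
  have hρm : Measurable ρ := Measure.measurable_rnDeriv _ _
  have key : ∀ k : ℕ, ∫⁻ x, (min (ρ x) k)^2 ≤ Q := by
    intro k
    have hm : Measurable (fun x => min (ρ x) (k:ℝ≥0∞)) := hρm.min measurable_const
    have h1 := lemD hQt hQ hm
    have h2 : ∫⁻ y, min (ρ y) k ∂ν = ∫⁻ x, ρ x * min (ρ x) k :=
      (lintegral_rnDeriv_mul hac hm.aemeasurable).symm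
    have h3 : ∫⁻ x, (min (ρ x) k)^2 ≤ ∫⁻ y, min (ρ y) k ∂ν := by
      rw [h2]; apply lintegral_mono; intro x
      simp only [sq]; gcongr; exact min_le_left _ _
    have h4 : ∫⁻ x, (min (ρ x) k)^2 ≠ ⊤ := by
      apply ne_top_of_le_ne_top _ h3
      apply ne_top_of_le_ne_top (b := ∫⁻ _, (k : ℝ≥0∞) ∂ν)
      · rw [lintegral_const]; exact ENNReal.mul_ne_top (by simp) (measure_ne_top _ _)
      · apply lintegral_mono; intro x; exact min_le_right _ _
    set I := ∫⁻ x, (min (ρ x) k)^2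
    have h5 : I * I ≤ Q * I := by
      rw [← sq]; exact (pow_le_pow_left' h3 2).trans h1
    by_cases h0 : I = 0
    · rw [h0]; simp
    · exact (ENNReal.mul_le_mul_iff_left h0 h4).1 h5
  have hlim : ∀ x, Tendsto (fun k : ℕ => (min (ρ x) (k:ℝ≥0∞))^2) atTop (𝓝 ((ρ x)^2)) := by
    intro x
    have : Tendsto (fun k : ℕ => min (ρ x) (k:ℝ≥0∞)) atTop (𝓝 (min (ρ x) ⊤)) :=
      tendsto_const_nhds.min ENNReal.tendsto_nat_nhds_top
    rw [min_top_right] at this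
    exact ENNReal.Tendsto.pow this
  calc _ = ∫⁻ x, liminf (fun k : ℕ => (min (ρ x) (k:ℝ≥0∞))^2) atTop := by
        congr 1; ext x; exact (hlim x).liminf_eq.symm
    _ ≤ liminf (fun k : ℕ => ∫⁻ x, (min (ρ x) (k:ℝ≥0∞))^2) atTop :=
        lintegral_liminf_le fun k => (hρm.min measurable_const).pow_const 2
    _ ≤ Q := by
      apply liminf_le_of_le
      · isBoundedDefault
      · intro b hb
        obtain ⟨k, hk⟩ := hb.exists
        exact hk.trans (key k)
end

lemma Gk1_sq_integrable : Integrable (fun w : EuclideanSpace ℝ (Fin n) => ‖w‖^2 * Gk 1 w) := by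
  have := (gauss2_integrable (n := n) (s := 1/4) (by norm_num)).const_mul ((4 * π * 1) ^ (-((n : ℝ) / 2)))
  refine this.congr (ae_of_all _ fun v => ?_)
  simp only [Gk]
  rw [mul_left_comm]
  congr 3; ring_nf

lemma mom_integrable (i j : Fin n) : Integrable (fun w : EuclideanSpace ℝ (Fin n) => w i * w j * Gk 1 w) := by
  have hG := Gk_cont (n := n) 1
  refine Gk1_sq_integrable.mono' (by fun_prop) (ae_of_all _ fun w => ?_)
  rw [norm_mul, norm_mul, Real.norm_of_nonneg (Gk_pos one_pos w).le, sq]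
  have := (Gk_pos one_pos w).le
  gcongr <;> exact PiLp.norm_apply_le w _

lemma mom_iso (e : EuclideanSpace ℝ (Fin n) ≃ₗᵢ[ℝ] EuclideanSpace ℝ (Fin n)) (F : EuclideanSpace ℝ (Fin n) → ℝ) :
    ∫ w, F (e w) * Gk 1 w = ∫ w, F w * Gk 1 w := by
  rw [← e.measurePreserving.integral_comp e.toHomeomorph.measurableEmbedding (fun w => F w * Gk 1 w)]
  congr 1; ext w
  simp only [Gk, LinearIsometryEquiv.norm_map]

lemma mom_off {i j : Fin n} (hij : i ≠ j) : ∫ w : EuclideanSpace ℝ (Fin n), w i * w j * Gk 1 w = 0 := by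
  let e : EuclideanSpace ℝ (Fin n) ≃ₗᵢ[ℝ] EuclideanSpace ℝ (Fin n) :=
    LinearIsometryEquiv.piLpCongrRight 2 (fun k => if k = i then LinearIsometryEquiv.neg ℝ else LinearIsometryEquiv.refl ℝ ℝ)
  have h := mom_iso e (fun w => w i * w j)
  have e1 : ∀ w, (e w) i = - w i := by intro w; simp [e]
  have e2 : ∀ w, (e w) j = w j := by intro w; simp [e, hij.symm]
  simp only [e1, e2] at h
  have : ∫ w : EuclideanSpace ℝ (Fin n), -w i * w j * Gk 1 w = - ∫ w : EuclideanSpace ℝ (Fin n), w i * w j * Gk 1 w := by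
    rw [← integral_neg]; congr 1; ext w; ring
  rw [this] at h
  linarith

lemma mom_diag (i j : Fin n) : ∫ w : EuclideanSpace ℝ (Fin n), w i * w i * Gk 1 w = ∫ w : EuclideanSpace ℝ (Fin n), w j * w j * Gk 1 w := by
  let e : EuclideanSpace ℝ (Fin n) ≃ₗᵢ[ℝ] EuclideanSpace ℝ (Fin n) :=
    LinearIsometryEquiv.piLpCongrLeft 2 ℝ ℝ (Equiv.swap i j)
  have h := mom_iso e (fun w => w j * w j)
  have e1 : ∀ w, (e w) j = w i := by intro w; simp [e, LinearIsometryEquiv.piLpCongrLeft_apply, Equiv.piCongrLeft']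
  simp only [e1] at h
  exact h

lemma trace_zero (T : EuclideanSpace ℝ (Fin n) →L[ℝ] EuclideanSpace ℝ (Fin n))
    (hT : ∑ i, (T (EuclideanSpace.single i 1)) i = 0) :
    ∫ w, inner ℝ (T w) w * Gk 1 w = 0 := by
  have e : ∀ w : EuclideanSpace ℝ (Fin n), inner ℝ (T w) w * Gk 1 w =
      ∑ i, ∑ j, (T (EuclideanSpace.single j 1)) i * (w j * w i * Gk 1 w) := by
    intro w
    have hw : w = ∑ j, w j • EuclideanSpace.single j (1:ℝ) := by
      ext k; simp [Finset.sum_apply, Pi.single_apply]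
    have h1 : ∀ i, (T w) i = ∑ j, w j * (T (EuclideanSpace.single j 1)) i := by
      intro i
      conv_lhs => rw [hw]
      simp [map_sum]
    rw [PiLp.inner_apply, Finset.sum_mul]
    apply Finset.sum_congr rfl
    intro i _
    simp only [RCLike.inner_apply, conj_trivial]
    rw [h1, Finset.mul_sum, Finset.sum_mul]
    apply Finset.sum_congr rfl
    intro j _; ring
  simp_rw [e]
  rw [integral_finsetSum _ (fun i _ => integrable_finsetSum _ fun j _ => (mom_integrable j i).const_mul _)]
  simp_rw [integral_finsetSum _ (fun j _ => (mom_integrable j _).const_mul _), integral_const_mul]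
  have h2 : ∀ i : Fin n, ∑ j, (T (EuclideanSpace.single j 1)) i * ∫ w : EuclideanSpace ℝ (Fin n), w j * w i * Gk 1 w
      = (T (EuclideanSpace.single i 1)) i * ∫ w : EuclideanSpace ℝ (Fin n), w i * w i * Gk 1 w := by
    intro i
    apply Finset.sum_eq_single i
    · intro j _ hj; rw [mom_off hj, mul_zero]
    · simp
  simp_rw [h2]
  rcases isEmpty_or_nonempty (Fin n) with h | ⟨⟨i0⟩⟩
  · simp
  · simp_rw [fun i => mom_diag i i0]
    rw [← Finset.sum_mul, hT, zero_mul]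

lemma H_scale (a : EuclideanSpace ℝ (Fin n) → EuclideanSpace ℝ (Fin n)) {r : ℝ} (hr : 0 < r)
    (y : EuclideanSpace ℝ (Fin n)) :
    ∫ y', kern a (r^2) (y, y') = ∫ w, 1/4 * (inner ℝ (r⁻¹ • (a y - a (y - r • w))) w * Gk 1 w) := by
  rw [← integral_sub_left_eq_self (fun y' => kern a (r^2) (y, y')) volume y]
  have h := Measure.integral_comp_smul (volume : Measure (EuclideanSpace ℝ (Fin n))) (fun z => kern a (r^2) (y, y - z)) r
  have hrn : 0 < r^n := by positivity
  simp only [finrank_euclideanSpace, Fintype.card_fin, abs_of_pos (inv_pos.2 hrn), smul_eq_mul] at h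
  have h2 : ∫ z, kern a (r^2) (y, y - z) = r^n * ∫ w, kern a (r^2) (y, y - r • w) := by
    rw [h]; field_simp
  rw [h2, ← integral_const_mul]
  congr 1; ext w
  simp only [kern, sub_sub_cancel, Gk_scale hr, inner_smul_left, inner_smul_right, conj_trivial]
  field_simp

lemma H_tendsto {a : EuclideanSpace ℝ (Fin n) → EuclideanSpace ℝ (Fin n)} {L : NNReal} (ha : LipschitzWith L a)
    {y : EuclideanSpace ℝ (Fin n)} {T : EuclideanSpace ℝ (Fin n) →L[ℝ] EuclideanSpace ℝ (Fin n)}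
    (hT : HasFDerivAt a T y) (htr : ∑ i, (T (EuclideanSpace.single i 1)) i = 0)
    {r : ℕ → ℝ} (hr : ∀ k, 0 < r k) (hr0 : Tendsto r atTop (𝓝 0)) :
    Tendsto (fun k => ∫ y', kern a ((r k)^2) (y, y')) atTop (𝓝 0) := by
  simp_rw [fun k => H_scale a (hr k) y]
  have h0 : ∫ w, 1/4 * (inner ℝ (T w) w * Gk 1 w) = 0 := by
    rw [integral_const_mul, trace_zero T htr, mul_zero]
  rw [← h0]
  have hG := Gk_cont (n := n) 1
  have hac := ha.continuous
  apply tendsto_integral_of_dominated_convergence (fun w => 1/4 * (L * (‖w‖^2 * Gk 1 w)))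
  · intro k; exact (by fun_prop : Continuous _).aestronglyMeasurable
  · exact (Gk1_sq_integrable.const_mul _).const_mul _
  · intro k
    refine ae_of_all _ fun w => ?_
    have hk := hr k
    have hg := (Gk_pos one_pos w).le
    rw [norm_mul, norm_mul, Real.norm_of_nonneg (by norm_num : (0:ℝ) ≤ 1/4), Real.norm_of_nonneg hg]
    have h1 : ‖a y - a (y - r k • w)‖ ≤ L * (r k * ‖w‖) := by
      have := ha.dist_le_mul y (y - r k • w)
      rwa [dist_eq_norm, dist_eq_norm, sub_sub_cancel, norm_smul, Real.norm_of_nonneg hk.le] at this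
    have h2 : ‖inner ℝ ((r k)⁻¹ • (a y - a (y - r k • w))) w‖ ≤ L * ‖w‖^2 := by
      calc _ ≤ ‖(r k)⁻¹ • (a y - a (y - r k • w))‖ * ‖w‖ := norm_inner_le_norm _ _
        _ = (r k)⁻¹ * ‖a y - a (y - r k • w)‖ * ‖w‖ := by rw [norm_smul, Real.norm_of_nonneg (by positivity)]
        _ ≤ (r k)⁻¹ * (L * (r k * ‖w‖)) * ‖w‖ := by gcongr
        _ = _ := by field_simp
    rw [← mul_assoc (L : ℝ)]
    gcongr
  · refine ae_of_all _ fun w => ?_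
    apply Tendsto.const_mul
    apply Tendsto.mul_const
    apply Tendsto.inner _ tendsto_const_nhds
    have hc : Tendsto (fun k => ‖-(r k)⁻¹‖) atTop atTop := by
      simp only [norm_neg]
      have : Tendsto (fun k => r k) atTop (𝓝[>] 0) :=
        tendsto_nhdsWithin_iff.2 ⟨hr0, Eventually.of_forall hr⟩
      exact tendsto_norm_atTop_atTop.comp (tendsto_inv_nhdsGT_zero.comp this)
    refine (hT.lim w hc).congr fun k => ?_
    rw [inv_neg, inv_inv, neg_smul, neg_smul, ← smul_neg, neg_sub, sub_eq_add_neg y]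

lemma lin_int {α : Type*} [MeasurableSpace α] {m : Measure α} {f1 f2 g1 g2 h : α → ℝ} (C : ℝ)
    (hf1 : Integrable f1 m) (hf2 : Integrable f2 m) (hg1 : Integrable g1 m) (hg2 : Integrable g2 m) (hh : Integrable h m) :
    Integrable (fun p => 1/2 * (f1 p + f2 p) + (C/2 * (g1 p + g2 p) - C * h p)) m ∧
    ∫ p, (1/2 * (f1 p + f2 p) + (C/2 * (g1 p + g2 p) - C * h p)) ∂m =
      1/2 * ((∫ p, f1 p ∂m) + ∫ p, f2 p ∂m) + (C/2 * ((∫ p, g1 p ∂m) + ∫ p, g2 p ∂m) - C * ∫ p, h p ∂m) := by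
  have A : Integrable (fun p => 1/2 * (f1 p + f2 p)) m := (hf1.add hf2).const_mul _
  have B : Integrable (fun p => C/2 * (g1 p + g2 p)) m := (hg1.add hg2).const_mul _
  have D : Integrable (fun p => C * h p) m := hh.const_mul _
  have E : Integrable (fun p => C/2 * (g1 p + g2 p) - C * h p) m := B.sub D
  refine ⟨A.add E, ?_⟩
  rw [integral_add A E, integral_sub B D, integral_const_mul, integral_const_mul, integral_const_mul,
    integral_add hf1 hf2, integral_add hg1 hg2]

lemma shear_int {q : EuclideanSpace ℝ (Fin n) → ℝ} (hq : Integrable q) {s : ℝ} (hs : 0 < s) :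
    Integrable (fun p : EuclideanSpace ℝ (Fin n) × EuclideanSpace ℝ (Fin n) => q p.1 * Gk s (p.1 - p.2)) (volume.prod volume) := by
  have h := (Integrable.convolution_integrand (ContinuousLinearMap.mul ℝ ℝ) hq (Gk_integrable (n := n) hs)).swap
  refine h.congr (ae_of_all _ fun p => ?_)
  simp only [Function.comp, Prod.swap, ContinuousLinearMap.mul_apply']
  rw [← Gk_neg, neg_sub]

lemma kern_symm (a : EuclideanSpace ℝ (Fin n) → EuclideanSpace ℝ (Fin n)) (s : ℝ)
    (p : EuclideanSpace ℝ (Fin n) × EuclideanSpace ℝ (Fin n)) : kern a s p.swap = kern a s p := by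
  unfold kern
  simp only [Prod.fst_swap, Prod.snd_swap]
  rw [← neg_sub (a p.1), ← neg_sub p.1, inner_neg_neg, Gk_neg]

lemma H_bound {a : EuclideanSpace ℝ (Fin n) → EuclideanSpace ℝ (Fin n)} {L : NNReal} (ha : LipschitzWith L a)
    {s : ℝ} (hs : 0 < s) (y : EuclideanSpace ℝ (Fin n)) :
    |∫ y', kern a s (y, y')| ≤ L * 2 ^ ((n:ℝ)/2) := by
  have h2s : 0 < 2 * s := by positivity
  have hi : Integrable (fun y' : EuclideanSpace ℝ (Fin n) => Gk (2*s) (y - y')) := (Gk_integrable h2s).comp_sub_left y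
  calc |∫ y', kern a s (y, y')| ≤ ∫ y', L * 2 ^ ((n:ℝ)/2) * Gk (2*s) (y - y') :=
        norm_integral_le_of_norm_le (f := fun y' => kern a s (y, y')) (hi.const_mul (L * 2 ^ ((n:ℝ)/2))) (ae_of_all _ fun y' => kern_bound ha hs (y, y'))
    _ = _ := by
      rw [integral_const_mul, integral_sub_left_eq_self (fun z => Gk (2*s) z), Gk_integral h2s, mul_one]

lemma J_bound {a : EuclideanSpace ℝ (Fin n) → EuclideanSpace ℝ (Fin n)} {L : NNReal} (ha : LipschitzWith L a)
    {ρ : EuclideanSpace ℝ (Fin n) → ℝ} (hρm : Measurable ρ) (hρ0 : ∀ x, 0 ≤ ρ x) (hρ2 : Integrable (fun x => (ρ x)^2))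
    {ν : Measure (EuclideanSpace ℝ (Fin n))} [IsFiniteMeasure ν]
    (hν : ν = volume.withDensity (fun x => ENNReal.ofReal (ρ x))) {s : ℝ} (hs : 0 < s) :
    ∫ p, kern a s p ∂(ν.prod ν) ≤ (∫ y, (ρ y)^2 * ∫ y', kern a s (y, y')) +
      (L * 2 ^ ((n:ℝ)/2)) * ((∫ y, (ρ y)^2) - ∫ p, Gk (2*s) (p.1 - p.2) ∂(ν.prod ν)) := by
  have h2s : 0 < 2 * s := by positivity
  set C : ℝ := L * 2 ^ ((n:ℝ)/2) with hC
  have hC0 : 0 ≤ C := by positivity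
  have conv : ∀ F : EuclideanSpace ℝ (Fin n) × EuclideanSpace ℝ (Fin n) → ℝ,
      ∫ p, F p ∂(ν.prod ν) = ∫ p, (ρ p.1 * ρ p.2) * F p ∂((volume : Measure (EuclideanSpace ℝ (Fin n))).prod volume) := by
    intro F
    rw [hν, prod_withDensity hρm.ennreal_ofReal hρm.ennreal_ofReal, integral_withDensity_eq_integral_toReal_smul]
    · congr 1; ext p
      rw [ENNReal.toReal_mul, ENNReal.toReal_ofReal (hρ0 _), ENNReal.toReal_ofReal (hρ0 _), smul_eq_mul]
    · fun_prop
    · exact ae_of_all _ fun p => ENNReal.mul_lt_top ENNReal.ofReal_lt_top ENNReal.ofReal_lt_top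
  rw [conv, conv]
  have hkc := kern_cont ha.continuous s
  have hGc := Gk_cont (n := n) (2*s)
  -- integrability
  have i1 := shear_int hρ2 h2s
  have i2 : Integrable (fun p : EuclideanSpace ℝ (Fin n) × EuclideanSpace ℝ (Fin n) => (ρ p.2)^2 * Gk (2*s) (p.1 - p.2)) (volume.prod volume) := by
    refine i1.swap.congr (ae_of_all _ fun p => ?_)
    simp only [Function.comp, Prod.swap]
    rw [← Gk_neg, neg_sub]
  have i3 : Integrable (fun p : EuclideanSpace ℝ (Fin n) × EuclideanSpace ℝ (Fin n) => (ρ p.1 * ρ p.2) * Gk (2*s) (p.1 - p.2)) (volume.prod volume) := by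
    refine (i1.add i2).mono' (by fun_prop) (ae_of_all _ fun p => ?_)
    have h1 := hρ0 p.1
    have h2 := hρ0 p.2
    have h3 := (Gk_pos h2s (p.1 - p.2)).le
    rw [Real.norm_of_nonneg (by positivity)]
    simp only [Pi.add_apply]
    rw [← add_mul]
    apply mul_le_mul_of_nonneg_right _ h3
    nlinarith [sq_nonneg (ρ p.1 - ρ p.2), sq_nonneg (ρ p.1), sq_nonneg (ρ p.2)]
  have k1 : Integrable (fun p : EuclideanSpace ℝ (Fin n) × EuclideanSpace ℝ (Fin n) => (ρ p.1)^2 * kern a s p) (volume.prod volume) := by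
    refine (i1.const_mul C).mono' (((hρm.comp measurable_fst).pow_const 2).mul hkc.measurable).aestronglyMeasurable (ae_of_all _ fun p => ?_)
    rw [norm_mul, Real.norm_of_nonneg (sq_nonneg _), mul_left_comm]
    exact mul_le_mul_of_nonneg_left (kern_bound ha hs p) (sq_nonneg _)
  have k2 : Integrable (fun p : EuclideanSpace ℝ (Fin n) × EuclideanSpace ℝ (Fin n) => (ρ p.2)^2 * kern a s p) (volume.prod volume) := by
    refine k1.swap.congr (ae_of_all _ fun p => ?_)
    simp only [Function.comp, kern_symm]; rfl
  have k3 : Integrable (fun p : EuclideanSpace ℝ (Fin n) × EuclideanSpace ℝ (Fin n) => (ρ p.1 * ρ p.2) * kern a s p) (volume.prod volume) := by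
    refine (i3.const_mul C).mono' (((hρm.comp measurable_fst).mul (hρm.comp measurable_snd)).mul hkc.measurable).aestronglyMeasurable (ae_of_all _ fun p => ?_)
    rw [norm_mul, Real.norm_of_nonneg (mul_nonneg (hρ0 _) (hρ0 _)), mul_left_comm]
    exact mul_le_mul_of_nonneg_left (kern_bound ha hs p) (mul_nonneg (hρ0 _) (hρ0 _))
  -- values
  have v1 : ∫ p : EuclideanSpace ℝ (Fin n) × EuclideanSpace ℝ (Fin n), (ρ p.1)^2 * Gk (2*s) (p.1 - p.2) ∂(volume.prod volume) = ∫ y, (ρ y)^2 := by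
    rw [integral_prod _ i1]
    congr 1; ext y
    simp only
    rw [integral_const_mul, integral_sub_left_eq_self (fun z => Gk (2*s) z), Gk_integral h2s, mul_one]
  have v2 : ∫ p : EuclideanSpace ℝ (Fin n) × EuclideanSpace ℝ (Fin n), (ρ p.2)^2 * Gk (2*s) (p.1 - p.2) ∂(volume.prod volume) = ∫ y, (ρ y)^2 := by
    rw [← v1, ← integral_prod_swap]
    congr 1; ext p
    simp only [Prod.swap]
    rw [← Gk_neg, neg_sub]
  have w1 : ∫ p : EuclideanSpace ℝ (Fin n) × EuclideanSpace ℝ (Fin n), (ρ p.1)^2 * kern a s p ∂(volume.prod volume) = ∫ y, (ρ y)^2 * ∫ y', kern a s (y, y') := by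
    rw [integral_prod _ k1]
    congr 1; ext y
    simp only
    rw [integral_const_mul]
  have w2 : ∫ p : EuclideanSpace ℝ (Fin n) × EuclideanSpace ℝ (Fin n), (ρ p.2)^2 * kern a s p ∂(volume.prod volume) = ∫ y, (ρ y)^2 * ∫ y', kern a s (y, y') := by
    rw [← w1, ← integral_prod_swap]
    congr 1; ext p
    rw [kern_symm]; rfl
  obtain ⟨I1, hI2⟩ := lin_int C k1 k2 i1 i2 i3
  calc _ ≤ ∫ p, (1/2 * ((ρ p.1)^2 * kern a s p + (ρ p.2)^2 * kern a s p) +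
        (C/2 * ((ρ p.1)^2 * Gk (2*s) (p.1 - p.2) + (ρ p.2)^2 * Gk (2*s) (p.1 - p.2)) -
          C * ((ρ p.1 * ρ p.2) * Gk (2*s) (p.1 - p.2)))) ∂((volume : Measure (EuclideanSpace ℝ (Fin n))).prod volume) := by
        apply integral_mono k3 I1
        intro p
        have hb := (abs_le.1 (kern_bound ha hs p)).1
        simp only
        rw [← hC] at hb
        nlinarith [mul_nonneg (sq_nonneg (ρ p.1 - ρ p.2)) (by linarith : 0 ≤ kern a s p + C * Gk (2*s) (p.1 - p.2))]
    _ = 1/2 * ((∫ y, (ρ y)^2 * ∫ y', kern a s (y, y')) + ∫ y, (ρ y)^2 * ∫ y', kern a s (y, y')) +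
        (C/2 * ((∫ y, (ρ y)^2) + ∫ y, (ρ y)^2) - C * ∫ p, (ρ p.1 * ρ p.2) * Gk (2*s) (p.1 - p.2) ∂((volume : Measure (EuclideanSpace ℝ (Fin n))).prod volume)) := by
        rw [hI2, v1, v2, w1, w2]
    _ = _ := by ring

lemma rhoH_tendsto {a : EuclideanSpace ℝ (Fin n) → EuclideanSpace ℝ (Fin n)} {L : NNReal} (ha : LipschitzWith L a)
    {ρ : EuclideanSpace ℝ (Fin n) → ℝ} (hρ2 : Integrable (fun x => (ρ x)^2))
    (hT : ∀ᵐ y, ρ y = 0 ∨ (DifferentiableAt ℝ a y ∧ ∑ i, (fderiv ℝ a y (EuclideanSpace.single i 1)) i = 0))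
    {r : ℕ → ℝ} (hr : ∀ k, 0 < r k) (hr0 : Tendsto r atTop (𝓝 0)) :
    Tendsto (fun k => ∫ y, (ρ y)^2 * ∫ y', kern a ((r k)^2) (y, y')) atTop (𝓝 0) := by
  rw [← integral_zero (EuclideanSpace ℝ (Fin n)) ℝ (μ := volume)]
  apply tendsto_integral_of_dominated_convergence (fun y => (ρ y)^2 * (L * 2 ^ ((n:ℝ)/2)))
  · intro k
    apply hρ2.aestronglyMeasurable.mul
    exact (kern_cont ha.continuous _).stronglyMeasurable.integral_prod_right'.aestronglyMeasurable
  · exact hρ2.mul_const _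
  · intro k
    refine ae_of_all _ fun y => ?_
    rw [norm_mul, Real.norm_of_nonneg (sq_nonneg _)]
    exact mul_le_mul_of_nonneg_left (H_bound ha (pow_pos (hr k) 2) y) (sq_nonneg _)
  · filter_upwards [hT] with y hy
    rcases hy with h | ⟨h1, h2⟩
    · simp [h]
    · simpa using (H_tendsto ha h1.hasFDerivAt h2 hr hr0).const_mul ((ρ y)^2)

lemma ball_moment (hn : 1 ≤ n) {R : ℝ} (hR : 0 ≤ R) :
    ∫ ξ : EuclideanSpace ℝ (Fin n), (Set.Ioc 0 R).indicator (fun y => R^2 - y^2) ‖ξ‖ =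
      2 / ((n:ℝ) + 2) * R^2 * (volume.real (Metric.ball (0 : EuclideanSpace ℝ (Fin n)) 1) * R^n) := by
  have : Nonempty (Fin n) := ⟨⟨0, hn⟩⟩
  rw [integral_fun_norm_addHaar volume ((Set.Ioc 0 R).indicator (fun y => R^2 - y^2))]
  simp only [finrank_euclideanSpace, Fintype.card_fin, nsmul_eq_mul, smul_eq_mul]
  have h1 : ∫ y in Set.Ioi (0:ℝ), y^(n-1) * (Set.Ioc 0 R).indicator (fun y => R^2 - y^2) y =
      ∫ y in (0:ℝ)..R, (R^2 * y^(n-1) - y^(n+1)) := by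
    rw [intervalIntegral.integral_of_le hR]
    have e : ∀ y : ℝ, y^(n-1) * (Set.Ioc 0 R).indicator (fun y => R^2 - y^2) y =
        (Set.Ioc 0 R).indicator (fun y => R^2 * y^(n-1) - y^(n+1)) y := by
      intro y
      by_cases hy : y ∈ Set.Ioc 0 R
      · simp only [Set.indicator_of_mem hy]
        have : y^(n+1) = y^(n-1) * y^2 := by rw [← pow_add]; congr 1; omega
        rw [this]; ring
      · simp [Set.indicator_of_notMem hy]
    simp_rw [e]
    rw [setIntegral_indicator measurableSet_Ioc]
    congr 2
    ext y; simp only [Set.mem_inter_iff, Set.mem_Ioi, Set.mem_Ioc]; tauto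
  rw [h1, intervalIntegral.integral_sub (Continuous.intervalIntegrable (by fun_prop) _ _) (Continuous.intervalIntegrable (by fun_prop) _ _), intervalIntegral.integral_const_mul,
    integral_pow, integral_pow]
  obtain ⟨m, rfl⟩ : ∃ m, n = m + 1 := ⟨n - 1, by omega⟩
  simp only [Nat.add_sub_cancel]
  push_cast
  field_simp
  ring

section
variable {ν : Measure (EuclideanSpace ℝ (Fin n))} [IsFiniteMeasure ν]

lemma bathtub (hn : 1 ≤ n) {R : ℝ} (hR : 0 ≤ R)
    (hRc : (ν.real Set.univ)^2 * (volume.real (Metric.ball (0 : EuclideanSpace ℝ (Fin n)) 1) * R^n) = ∫ ξ, Fe ν ξ)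
    {s : ℝ} (hs : 0 < s) :
    R^2 * Ph ν s - Ps ν s ≤ 2 / ((n:ℝ) + 2) * R^2 * ∫ ξ, Fe ν ξ := by
  set c := (ν.real Set.univ)^2 with hc
  have hc0 : 0 ≤ c := sq_nonneg _
  have i1 := mul_Fe_integrable ν (gauss_integrable hs)
  have i2 := mul_Fe_integrable ν (gauss2_integrable hs)
  have hint : Integrable (fun ξ : EuclideanSpace ℝ (Fin n) => (Set.Ioc 0 R).indicator (fun y => R^2 - y^2) ‖ξ‖) := by
    have hb : Integrable ((Metric.closedBall (0 : EuclideanSpace ℝ (Fin n)) R).indicator (fun _ => R^2)) :=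
      (integrable_indicator_iff measurableSet_closedBall).2 (integrableOn_const (by exact measure_closedBall_lt_top.ne))
    refine hb.mono' ?_ (ae_of_all _ fun ξ => ?_)
    · exact (((by fun_prop : Measurable fun y : ℝ => R^2 - y^2).indicator measurableSet_Ioc).comp measurable_norm).aestronglyMeasurable
    · by_cases h : ‖ξ‖ ∈ Set.Ioc 0 R
      · have h2 : ξ ∈ Metric.closedBall (0 : EuclideanSpace ℝ (Fin n)) R := by simpa using h.2
        rw [Set.indicator_of_mem h, Set.indicator_of_mem h2, Real.norm_of_nonneg (by nlinarith [h.1, h.2])]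
        nlinarith [sq_nonneg ‖ξ‖]
      · rw [Set.indicator_of_notMem h, norm_zero]
        exact Set.indicator_nonneg (fun _ _ => sq_nonneg R) _
  have hpt : ∀ᵐ ξ : EuclideanSpace ℝ (Fin n), R^2 * (Real.exp (-s * ‖ξ‖^2) * Fe ν ξ) - (‖ξ‖^2 * Real.exp (-s * ‖ξ‖^2)) * Fe ν ξ ≤
      c * (Set.Ioc 0 R).indicator (fun y => R^2 - y^2) ‖ξ‖ := by
    have : Nonempty (Fin n) := ⟨⟨0, hn⟩⟩
    have h0 : ∀ᵐ ξ : EuclideanSpace ℝ (Fin n), ξ ≠ 0 := by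
      rw [ae_iff]; simp
    filter_upwards [h0] with ξ hξ
    have hpos : 0 < ‖ξ‖ := norm_pos_iff.2 hξ
    have hF0 := Fe_nonneg ν ξ
    have hFc := Fe_le ν ξ
    have he0 := Real.exp_pos (-s * ‖ξ‖^2)
    have he1 : Real.exp (-s * ‖ξ‖^2) ≤ 1 := Real.exp_le_one_iff.2 (by nlinarith [sq_nonneg ‖ξ‖])
    have hE : Real.exp (-s * ‖ξ‖^2) * Fe ν ξ ≤ c := by nlinarith
    have hE0 : 0 ≤ Real.exp (-s * ‖ξ‖^2) * Fe ν ξ := by positivity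
    by_cases h : ‖ξ‖ ≤ R
    · have hmem : ‖ξ‖ ∈ Set.Ioc 0 R := ⟨hpos, h⟩
      rw [Set.indicator_of_mem hmem]
      have : 0 ≤ R^2 - ‖ξ‖^2 := by nlinarith
      nlinarith
    · rw [Set.indicator_of_notMem (fun hh : ‖ξ‖ ∈ Set.Ioc 0 R => h hh.2)]
      push Not at h
      have : R^2 - ‖ξ‖^2 ≤ 0 := by nlinarith
      nlinarith
  have h := integral_mono_ae ((i1.const_mul (R^2)).sub i2) (hint.const_mul c) hpt
  have e1 : ∫ ξ, (R^2 * (Real.exp (-s * ‖ξ‖^2) * Fe ν ξ) - (‖ξ‖^2 * Real.exp (-s * ‖ξ‖^2)) * Fe ν ξ) = R^2 * Ph ν s - Ps ν s := by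
    rw [integral_sub (i1.const_mul (R^2)) i2, integral_const_mul]; rfl
  rw [integral_const_mul, ball_moment hn hR] at h
  rw [← hRc]
  calc _ = _ := e1.symm
    _ ≤ _ := h
    _ = _ := by ring

lemma lower_bound (hn : 1 ≤ n) {d μ : ℝ} (hd : 0 < d) (hμ : 0 < μ)
    {a : EuclideanSpace ℝ (Fin n) → EuclideanSpace ℝ (Fin n)}
    {L : NNReal} (ha : LipschitzWith L a)
    {Ω : Set (EuclideanSpace ℝ (Fin n))} (hbdd : Bornology.IsBounded Ω) (hfr : volume (frontier Ω) = 0)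
    (hT : ∀ y ∈ Ω, DifferentiableAt ℝ a y ∧ ∑ i, (fderiv ℝ a y (EuclideanSpace.single i 1)) i = 0)
    (hν : ν (closure Ω)ᶜ = 0) (hν0 : ν ≠ 0)
    (htest : ∀ ψ : EuclideanSpace ℝ (Fin n) → ℝ, ContDiff ℝ 2 ψ → (∀ x, 0 ≤ ψ x) →
        0 ≤ ∫ x, Lop d μ a ψ x ∂ν) :
    ∃ R : ℝ, 0 < R ∧ d * n * R^2 ≤ ((n:ℝ) + 2) * μ ∧
      (2 * π)^n ≤ volume.real (Metric.ball (0 : EuclideanSpace ℝ (Fin n)) 1) * volume.real Ω * R^n := by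
  have hK : IsCompact (closure Ω) := hbdd.isCompact_closure
  obtain ⟨M, hM⟩ := Ph_bdd hd hμ ha hK hν htest
  have hF := Fe_integrable hM
  set Φ := ∫ ξ, Fe ν ξ with hΦ
  set q : ℝ := ((2 * π)^n)⁻¹ * Φ with hq
  have hpi : 0 < (2 * π)^n := by positivity
  have hΦ0 : 0 ≤ Φ := integral_nonneg fun ξ => Fe_nonneg ν ξ
  have hq0 : 0 ≤ q := by positivity
  have hQr : ∀ s, 0 < s → ∫ p, Gk s (p.1 - p.2) ∂(ν.prod ν) = ((2 * π)^n)⁻¹ * Ph ν s := by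
    intro s hs
    rw [← Q_eq ν hs]; field_simp
  have hQ : ∀ s, 0 < s → ∫⁻ p, ENNReal.ofReal (Gk s (p.1 - p.2)) ∂(ν.prod ν) ≤ ENNReal.ofReal q := by
    intro s hs
    have hG := Gk_cont (n := n) s
    rw [← ofReal_integral_eq_lintegral_ofReal (cont_int ν hK hν (by fun_prop)) (ae_of_all _ fun p => (Gk_pos hs _).le), hQr s hs]
    apply ENNReal.ofReal_le_ofReal
    have := Ph_le hF hs
    rw [hq]; gcongr
  have hac := lemD_ac ENNReal.ofReal_ne_top hQ
  have hL2 := lemD_L2 ENNReal.ofReal_ne_top hQ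
  have hmass := lemD_mass ENNReal.ofReal_ne_top hQ (A := closure Ω) isClosed_closure.measurableSet
  -- density
  set ρ : EuclideanSpace ℝ (Fin n) → ℝ := fun x => (ν.rnDeriv volume x).toReal with hρ
  have hρm : Measurable ρ := (Measure.measurable_rnDeriv _ _).ennreal_toReal
  have hρ0 : ∀ x, 0 ≤ ρ x := fun x => ENNReal.toReal_nonneg
  have hρae : ∀ᵐ x, ENNReal.ofReal (ρ x) = ν.rnDeriv volume x := by
    filter_upwards [Measure.rnDeriv_lt_top ν volume] with x hx
    exact ENNReal.ofReal_toReal hx.ne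
  have hνρ : ν = volume.withDensity (fun x => ENNReal.ofReal (ρ x)) := by
    rw [withDensity_congr_ae hρae, Measure.withDensity_rnDeriv_eq _ _ hac]
  have hl2 : ∫⁻ x, ENNReal.ofReal ((ρ x)^2) ≤ ENNReal.ofReal q := by
    refine le_trans (le_of_eq (lintegral_congr_ae ?_)) hL2
    filter_upwards [hρae] with x hx
    rw [ENNReal.ofReal_pow (hρ0 x), hx]
  have hρ2 : Integrable (fun x => (ρ x)^2) := by
    refine ⟨(hρm.pow_const 2).aestronglyMeasurable, ?_⟩
    rw [hasFiniteIntegral_iff_ofReal (ae_of_all _ fun x => sq_nonneg (ρ x))]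
    exact hl2.trans_lt ENNReal.ofReal_lt_top
  have hρq : ∫ x, (ρ x)^2 ≤ q := by
    rw [← ENNReal.ofReal_le_ofReal_iff hq0, ofReal_integral_eq_lintegral_ofReal hρ2 (ae_of_all _ fun x => sq_nonneg (ρ x))]
    exact hl2
  have hTae : ∀ᵐ y, ρ y = 0 ∨ (DifferentiableAt ℝ a y ∧ ∑ i, (fderiv ℝ a y (EuclideanSpace.single i 1)) i = 0) := by
    have h1 : ∀ᵐ y, y ∈ (closure Ω)ᶜ → ν.rnDeriv volume y = 0 := by
      rw [← setLIntegral_eq_zero_iff isClosed_closure.measurableSet.compl (Measure.measurable_rnDeriv _ _),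
        Measure.setLIntegral_rnDeriv hac, hν]
    have h2 : ∀ᵐ y : EuclideanSpace ℝ (Fin n), y ∉ frontier Ω := measure_eq_zero_iff_ae_notMem.1 hfr
    filter_upwards [h1, h2] with y hy1 hy2
    by_cases hy : y ∈ closure Ω
    · right
      apply hT
      by_contra hyΩ
      exact hy2 ⟨hy, fun h => hyΩ (interior_subset h)⟩
    · left; simp [hρ, hy1 hy]
  -- mass
  have hcl : volume (closure Ω) ≤ volume Ω := by
    rw [closure_eq_self_union_frontier]
    exact (measure_union_le _ _).trans (by rw [hfr, add_zero])
  have hVt : volume Ω ≠ ⊤ := hbdd.measure_lt_top.ne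
  have huniv : ν (closure Ω) = ν Set.univ := by
    rw [← measure_add_measure_compl (isClosed_closure (s := Ω)).measurableSet, hν, add_zero]
  set c := (ν.real Set.univ)^2 with hc
  have hm1 : 0 < ν.real Set.univ := by
    rw [Measure.real, ENNReal.toReal_pos_iff]
    exact ⟨Measure.measure_univ_pos.2 hν0, measure_lt_top _ _⟩
  have hc0 : 0 < c := by positivity
  set V := volume.real Ω with hV
  have hcV : c ≤ q * V := by
    have h : (ν Set.univ)^2 ≤ ENNReal.ofReal q * volume Ω := by
      rw [← huniv]; exact hmass.trans (by gcongr)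
    have := ENNReal.toReal_mono (ENNReal.mul_ne_top ENNReal.ofReal_ne_top hVt) h
    rwa [ENNReal.toReal_pow, ENNReal.toReal_mul, ENNReal.toReal_ofReal hq0] at this
  have hΦp : 0 < Φ := by
    rcases hΦ0.lt_or_eq with h | h
    · exact h
    · rw [hq, ← h] at hcV; simp at hcV; linarith
  set ω := volume.real (Metric.ball (0 : EuclideanSpace ℝ (Fin n)) 1) with hω
  have hω0 : 0 < ω := by
    rw [hω, Measure.real, ENNReal.toReal_pos_iff]
    exact ⟨Metric.measure_ball_pos _ _ one_pos, measure_ball_lt_top⟩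
  have hn0 : (n:ℝ) ≠ 0 := by positivity
  set R : ℝ := (Φ / (c * ω)) ^ ((n:ℝ)⁻¹) with hR
  have hR0 : 0 < R := by positivity
  have hRn : R^n = Φ / (c * ω) := by
    rw [hR, Real.rpow_inv_natCast_pow (by positivity) (by omega)]
  have hRc : c * (ω * R^n) = Φ := by rw [hRn]; field_simp
  refine ⟨R, hR0, ?_, ?_⟩
  · -- limit
    set r : ℕ → ℝ := fun k => 1 / ((k:ℝ) + 1) with hr
    have hr0 : ∀ k, 0 < r k := fun k => by simp only [hr]; positivity
    have hrl : Tendsto r atTop (𝓝 0) := tendsto_one_div_add_atTop_nhds_zero_nat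
    have hr2 : Tendsto (fun k => (r k)^2) atTop (𝓝 0) := by simpa using hrl.pow 2
    have hr22 : Tendsto (fun k => 2 * (r k)^2) atTop (𝓝 0) := by simpa using hr2.const_mul 2
    have t1 := Ph_tendsto hF (fun k => pow_pos (hr0 k) 2) hr2
    have t2 := Ph_tendsto hF (σ := fun k => 2 * (r k)^2) (fun k => mul_pos two_pos (pow_pos (hr0 k) 2)) hr22
    have t3 := rhoH_tendsto ha hρ2 hTae hr0 hrl
    set C : ℝ := L * 2 ^ ((n:ℝ)/2) with hC
    have hC0 : 0 ≤ C := by positivity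
    have ineq : ∀ k, d * (R^2 * Ph ν ((r k)^2) - 2 / ((n:ℝ) + 2) * R^2 * Φ) ≤
        μ * Ph ν ((r k)^2) + (2 * π)^n * ((∫ y, (ρ y)^2 * ∫ y', kern a ((r k)^2) (y, y')) +
          C * (q - ((2 * π)^n)⁻¹ * Ph ν (2 * (r k)^2))) := by
      intro k
      have hs : 0 < (r k)^2 := pow_pos (hr0 k) 2
      have b1 := bathtub hn hR0.le hRc hs
      have b2 := main_ineq ha.continuous hK hν htest hs
      have b3 := J_bound ha hρm hρ0 hρ2 hνρ hs
      rw [hQr _ (by positivity)] at b3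
      have b4 : C * ((∫ y, (ρ y)^2) - ((2 * π)^n)⁻¹ * Ph ν (2 * (r k)^2)) ≤ C * (q - ((2 * π)^n)⁻¹ * Ph ν (2 * (r k)^2)) := by
        gcongr
      have b5 := b3.trans (add_le_add_right b4 _)
      have b6 := mul_le_mul_of_nonneg_left b5 hpi.le
      have b7 := mul_le_mul_of_nonneg_left b1 hd.le
      linarith
    have lhs := ((t1.const_mul (R^2)).sub_const (2 / ((n:ℝ) + 2) * R^2 * Φ)).const_mul d
    have rhs := (t1.const_mul μ).add ((t3.add (((t2.const_mul ((2 * π)^n)⁻¹).const_sub q).const_mul C)).const_mul ((2 * π)^n))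
    have fin := le_of_tendsto_of_tendsto' lhs rhs ineq
    rw [← hΦ, ← hq, sub_self, mul_zero, add_zero, mul_zero, add_zero] at fin
    have e : d * (R^2 * Φ - 2 / ((n:ℝ) + 2) * R^2 * Φ) = (d * n * R^2 / ((n:ℝ) + 2)) * Φ := by
      field_simp; ring
    rw [e] at fin
    have := le_of_mul_le_mul_right fin hΦp
    rwa [div_le_iff₀ (by positivity), mul_comm μ] at this
  · rw [hRn]
    have : c * (2 * π)^n ≤ Φ * V := by
      calc c * (2 * π)^n ≤ q * V * (2 * π)^n := by gcongr
        _ = Φ * V := by rw [hq]; field_simp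
    have e : ω * V * (Φ / (c * ω)) = Φ * V / c := by field_simp
    rw [e, le_div_iff₀ hc0]
    linarith
end

lemma vol_contra {n : ℕ} (hn : 1 ≤ n) {d μ R V : ℝ} (hd : 0 < d) (hμ : 0 < μ) (hR : 0 < R)
    (h1 : d * n * R^2 ≤ ((n:ℝ) + 2) * μ)
    (h2 : (2 * π)^n ≤ volume.real (Metric.ball (0 : EuclideanSpace ℝ (Fin n)) 1) * V * R^n) :
    Real.Gamma (1 + (n : ℝ) / 2) * (4 * d * n * Real.pi / (((n : ℝ) + 2) * μ)) ^ ((n : ℝ) / 2) ≤ V := by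
  have : Nonempty (Fin n) := ⟨⟨0, hn⟩⟩
  have hn0 : (0:ℝ) < n := by exact_mod_cast hn
  have hG : 0 < Real.Gamma (1 + (n : ℝ) / 2) := Real.Gamma_pos_of_pos (by positivity)
  have hω : volume.real (Metric.ball (0 : EuclideanSpace ℝ (Fin n)) 1) = π ^ ((n:ℝ)/2) / Real.Gamma (1 + (n : ℝ) / 2) := by
    rw [Measure.real, EuclideanSpace.volume_ball]
    simp only [Fintype.card_fin, ENNReal.ofReal_one, one_pow, one_mul]
    rw [ENNReal.toReal_ofReal (by rw [add_comm] at hG; positivity), add_comm, Real.sqrt_eq_rpow, ← Real.rpow_natCast, ← Real.rpow_mul pi_pos.le]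
    congr 2; ring
  rw [hω] at h2
  have h3 : 4 * d * n * π / (((n : ℝ) + 2) * μ) ≤ 4 * π / R^2 := by
    rw [div_le_div_iff₀ (by positivity) (by positivity)]
    nlinarith [pi_pos]
  have h4 : (4 * d * n * π / (((n : ℝ) + 2) * μ)) ^ ((n : ℝ) / 2) ≤ (4 * π / R^2) ^ ((n : ℝ) / 2) :=
    Real.rpow_le_rpow (by positivity) h3 (by positivity)
  have pw : ∀ x : ℝ, 0 ≤ x → (x^2) ^ ((n:ℝ)/2) = x^n := by
    intro x hx
    rw [← Real.rpow_natCast x 2, ← Real.rpow_mul hx, ← Real.rpow_natCast]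
    congr 1; push_cast; ring
  have h5 : (4 * π / R^2) ^ ((n : ℝ) / 2) = 2^n * π ^ ((n:ℝ)/2) / R^n := by
    rw [Real.div_rpow (by positivity) (by positivity), pw R hR.le, Real.mul_rpow (by norm_num) pi_pos.le,
      show (4:ℝ) = 2^2 by norm_num, pw 2 (by norm_num)]
  have h6 : π^n = π ^ ((n:ℝ)/2) * π ^ ((n:ℝ)/2) := by
    rw [← Real.rpow_add pi_pos, ← Real.rpow_natCast]; congr 1; ring
  set P := π ^ ((n:ℝ)/2) with hP
  have hP0 : 0 < P := by positivity
  rw [mul_pow, h6] at h2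
  set G := Real.Gamma (1 + (n : ℝ) / 2)
  have hRn : 0 < R^n := by positivity
  have h7 : 2^n * P * G ≤ V * R^n := by
    have e : P / G * V * R^n = P * (V * R^n / G) := by field_simp
    rw [e] at h2
    have : 2^n * P ≤ V * R^n / G := by
      apply le_of_mul_le_mul_left _ hP0
      linarith
    rwa [le_div_iff₀ hG] at this
  calc G * _ ≤ G * (4 * π / R^2) ^ ((n : ℝ) / 2) := by gcongr
    _ = 2^n * P * G / R^n := by rw [h5]; ring
    _ ≤ V := by rwa [div_le_iff₀ hRn]

/-- Extinction on a smooth bounded domain of volume below the Li-Yau extreme volume size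
`V_ex = Γ(1+n/2)·[4dnπ/((n+2)(f'(0)+ln g'(0)))]^{n/2}`, with divergence free drift. -/
theorem extreme_volume_extinction_LiYau
    (n : ℕ) (hn : 1 ≤ n) (d : ℝ) (hd : 0 < d)
    (Ω : Set (EuclideanSpace ℝ (Fin n)))
    (hopen : IsOpen Ω) (hne : Ω.Nonempty) (hbdd : Bornology.IsBounded Ω)
    (hbd : HasCkBoundary ⊤ Ω)
    (a : EuclideanSpace ℝ (Fin n) → EuclideanSpace ℝ (Fin n))
    (ha : ContDiffOn ℝ 1 a (closure Ω))
    (hdiv : ∀ x ∈ Ω, (∑ i, pd (fun y => a y i) i x) = 0)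
    (f g : ℝ → ℝ) (f'0 g'0 : ℝ) (hf : SatF f f'0) (hg : SatGext g g'0)
    (hpos : 0 < f'0 + Real.log g'0)
    (hvol : volume Ω < ENNReal.ofReal (Real.Gamma (1 + (n : ℝ) / 2) *
      (4 * d * n * Real.pi / (((n : ℝ) + 2) * (f'0 + Real.log g'0))) ^ ((n : ℝ) / 2)))
    (sol : ImpSol n Ω d a f g) :
    ∀ x ∈ Ω, Tendsto (fun m => sol.N m x) atTop (𝓝 0) := by
  set κ := f'0 + Real.log g'0 with hκ
  have hK : IsCompact (closure Ω) := hbdd.isCompact_closure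
  have hVt : volume Ω ≠ ⊤ := hbdd.measure_lt_top.ne
  have hV : volume.real Ω < Real.Gamma (1 + (n : ℝ) / 2) *
      (4 * d * n * Real.pi / (((n : ℝ) + 2) * κ)) ^ ((n : ℝ) / 2) := by
    rwa [← ENNReal.ofReal_toReal hVt, ENNReal.ofReal_lt_ofReal_iff_of_nonneg ENNReal.toReal_nonneg] at hvol
  obtain ⟨μ, hμV, hμκ⟩ : ∃ μ, volume.real Ω < Real.Gamma (1 + (n : ℝ) / 2) *
      (4 * d * n * Real.pi / (((n : ℝ) + 2) * μ)) ^ ((n : ℝ) / 2) ∧ κ < μ := by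
    have hc : ContinuousAt (fun μ : ℝ => Real.Gamma (1 + (n : ℝ) / 2) *
      (4 * d * n * Real.pi / (((n : ℝ) + 2) * μ)) ^ ((n : ℝ) / 2)) κ := by
      apply ContinuousAt.mul continuousAt_const
      apply ContinuousAt.rpow_const
      · exact continuousAt_const.div (by fun_prop) (by positivity)
      · right; positivity
    have h1 : ∀ᶠ μ in 𝓝[>] κ, volume.real Ω < Real.Gamma (1 + (n : ℝ) / 2) *
      (4 * d * n * Real.pi / (((n : ℝ) + 2) * μ)) ^ ((n : ℝ) / 2) :=
      (hc.eventually (lt_mem_nhds hV)).filter_mono nhdsWithin_le_nhds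
    exact (h1.and self_mem_nhdsWithin).exists
  have hμ0 : 0 < μ := hpos.trans hμκ
  -- Lipschitz extension of the drift
  obtain ⟨L₀, hL₀⟩ := (lip_local hopen hbd ha).exists_lipschitzOnWith_of_compact hK
  obtain ⟨b, hbL, hba⟩ := hL₀.extend_finite_dimension
  have hSup : ∃ ψ : EuclideanSpace ℝ (Fin n) → ℝ, ContDiff ℝ 2 ψ ∧ (∀ x, 0 ≤ ψ x) ∧
      ∀ x ∈ closure Ω, Lop d μ b ψ x < 0 := by
    by_contra hno
    obtain ⟨ν, hfin, hν0, hνK, htest⟩ := exists_measure hbL.continuous hK hne.closure hno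
    have hT : ∀ y ∈ Ω, DifferentiableAt ℝ b y ∧ ∑ i, (fderiv ℝ b y (EuclideanSpace.single i 1)) i = 0 := by
      intro y hy
      have hΩn : Ω ∈ 𝓝 y := hopen.mem_nhds hy
      have hda : DifferentiableAt ℝ a y :=
        ((ha.contDiffAt (mem_of_superset hΩn subset_closure)).differentiableAt (by norm_num))
      have hev : b =ᶠ[𝓝 y] a := by
        filter_upwards [hΩn] with z hz
        exact (hba (subset_closure hz)).symm
      refine ⟨hda.congr_of_eventuallyEq hev, ?_⟩
      rw [hev.fderiv_eq, ← hdiv y hy]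
      apply Finset.sum_congr rfl
      intro i _
      unfold pd
      have h := ((EuclideanSpace.proj (𝕜 := ℝ) i).hasFDerivAt (x := a y)).comp y hda.hasFDerivAt
      have h' : HasFDerivAt (fun z => a z i) ((EuclideanSpace.proj (𝕜 := ℝ) i).comp (fderiv ℝ a y)) y := h
      rw [h'.fderiv]; rfl
    obtain ⟨R, hR, h1, h2⟩ := lower_bound hn hd hμ0 hbL hbdd (frontier_null hbd) hT hνK hν0 htest
    exact absurd (vol_contra hn hd hμ0 hR h1 h2) (not_le.2 hμV)
  obtain ⟨ψ, hψ, hψ0, hψL⟩ := hSup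
  have hcont : Continuous (Lop d μ b ψ) := Lop_cont hbL.continuous hψ
  obtain ⟨x₀, hx₀, hmax⟩ := hK.exists_isMaxOn hne.closure hcont.continuousOn
  set ε := -(Lop d μ b ψ x₀) / (2 * μ) with hε
  have hε0 : 0 < ε := div_pos (by linarith [hψL x₀ hx₀]) (by positivity)
  have hεe : μ * ε = -(Lop d μ b ψ x₀) / 2 := by rw [hε]; field_simp
  refine extinction_of_super (r := f'0) (γ := g'0) (μ := μ) (ψ := fun x => ψ x + ε) hd hopen hne hbdd ?_ hg.2.2.2.2.1 ?_ hμκ ?_ ?_ ?_ sol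
  · intro N hN
    obtain ⟨-, -, -, -, h, -, -, -, hh⟩ := hf
    exact (hh N hN).2
  · intro N hN
    rcases hN.eq_or_lt with h | h
    · rw [← h, hg.2.1, mul_zero]
    · exact hg.2.2.2.2.2 N h
  · fun_prop
  · intro x _; have := hψ0 x; positivity
  · intro x hx
    have hp : ∀ i, pd (fun x => ψ x + ε) i = pd ψ i := by
      intro i; ext z; unfold pd; rw [fderiv_add_const]
    have hl : lap (fun x => ψ x + ε) x = lap ψ x := by
      unfold lap pd2; simp only [hp]
    have hax : a x = b x := hba (subset_closure hx)
    rw [hl]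
    simp only [hp, hax]
    have hm : Lop d μ b ψ x ≤ Lop d μ b ψ x₀ := hmax (subset_closure hx)
    have hneg := hψL x₀ hx₀
    have e : d * lap ψ x - (∑ i, b x i * pd ψ i x) + μ * (ψ x + ε) = Lop d μ b ψ x + μ * ε := by
      unfold Lop; ring
    rw [e, hεe]; linarith
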